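/- arXiv:2208.03965 — 6 statements merged into one kernel-verified Lean document; each statement's English description precedes it below -/
import Mathlib

section
/- Let p, b, f : [-1,1] → ℝ be infinitely differentiable with p(x) ≥ p₀ > 0 and b(x) ≥ 0 on [-1,1], and fix boundary values u_L, u_R ∈ ℝ. Then there exists a constant C > 0, independent of ε, such that for every ε ∈ (0,1] and every u ∈ C²([-1,1]) satisfying -ε u''(x) + p(x) u'(x) + b(x) u(x) = f(x) on (-1,1) with u(-1) = u_L and u(1) = u_R, one has |(1-x) u'(x)| ≤ C for all x ∈ (-1,1). -/
open Set

open Filter Topology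

/-- Second-order necessary condition at an interior maximum. -/
lemma deriv_deriv_nonpos_of_isLocalMax {φ : ℝ → ℝ} {z : ℝ} (h : IsLocalMax φ z)
    (hc : ContinuousAt φ z) : deriv (deriv φ) z ≤ 0 := by
  by_contra! hpos
  have hmin := isLocalMin_of_deriv_deriv_pos hpos h.deriv_eq_zero hc
  have heq : φ =ᶠ[𝓝 z] fun _ => φ z := by
    filter_upwards [h, hmin] with y h₁ h₂ using le_antisymm h₁ h₂
  have h2 := heq.deriv.deriv_eq
  simp at h2
  linarith

/-- Upper bound from the maximum principle with a linear barrier. -/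
lemma le_of_convection_diffusion_le {p b u : ℝ → ℝ} {p₀ ε A B F : ℝ} (hε : 0 < ε)
    (hplb : ∀ x ∈ Icc (-1 : ℝ) 1, p₀ ≤ p x) (hbnn : ∀ x ∈ Icc (-1 : ℝ) 1, 0 ≤ b x)
    (hA : 0 ≤ A) (hB : 0 ≤ B) (hF : F < p₀ * B)
    (hc : ContinuousOn u (Icc (-1) 1)) (hd : ∀ x ∈ Ioo (-1 : ℝ) 1, DifferentiableAt ℝ u x)
    (hu : ∀ x ∈ Ioo (-1 : ℝ) 1,
      -ε * deriv (deriv u) x + p x * deriv u x + b x * u x ≤ F)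
    (hl : u (-1) ≤ A) (hr : u 1 ≤ A) :
    ∀ x ∈ Icc (-1 : ℝ) 1, u x ≤ A + 2 * B := by
  obtain ⟨z, hz, hmax⟩ := isCompact_Icc.exists_isMaxOn (nonempty_Icc.2 (by norm_num))
    (hc.sub (continuousOn_const.mul continuousOn_id) : ContinuousOn (fun x => u x - B * x) _)
  suffices hzle : u z - B * z ≤ A + B by
    intro x hx
    have h1 : u x - B * x ≤ u z - B * z := hmax hx
    nlinarith [hx.2]
  by_contra! hgt
  have hz1 : z ≠ -1 := by rintro rfl; linarith
  have hz2 : z ≠ 1 := by rintro rfl; linarith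
  have hzI : z ∈ Ioo (-1 : ℝ) 1 := ⟨lt_of_le_of_ne hz.1 hz1.symm, lt_of_le_of_ne hz.2 hz2⟩
  have hloc : IsLocalMax (fun x => u x - B * x) z :=
    hmax.isLocalMax (Icc_mem_nhds hzI.1 hzI.2)
  have hder : ∀ x ∈ Ioo (-1 : ℝ) 1, HasDerivAt (fun x => u x - B * x) (deriv u x - B) x := by
    intro x hx
    exact (hd x hx).hasDerivAt.fun_sub (by simpa using (hasDerivAt_id x).const_mul B)
  have h1 : deriv u z - B = 0 := hloc.hasDerivAt_eq_zero (hder z hzI)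
  have h2 := deriv_deriv_nonpos_of_isLocalMax hloc (hder z hzI).continuousAt
  have heq : deriv (fun x => u x - B * x) =ᶠ[𝓝 z] fun x => deriv u x - B := by
    filter_upwards [Ioo_mem_nhds hzI.1 hzI.2] with x hx using (hder x hx).deriv
  rw [heq.deriv_eq, deriv_sub_const] at h2
  have h3 : deriv u z = B := by linarith
  have h4 := hu z hzI
  rw [h3] at h4
  have huz : 0 ≤ u z := by nlinarith [hz.1]
  nlinarith [mul_nonneg (hbnn z hz) huz, mul_nonneg hε.le (neg_nonneg.2 h2),
    mul_le_mul_of_nonneg_right (hplb z hz) hB]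

/-- A function that increases wherever it exceeds `m` stays below `m` to the left of any point
where it is at most `m`. -/
lemma le_of_deriv_pos_of_gt {v : ℝ → ℝ} {x y m : ℝ} (hxy : x ≤ y)
    (hd : ∀ t ∈ Icc x y, DifferentiableAt ℝ v t)
    (hpos : ∀ t ∈ Icc x y, m < v t → 0 < deriv v t) (hy : v y ≤ m) : v x ≤ m := by
  obtain ⟨z, hz, hmax⟩ := isCompact_Icc.exists_isMaxOn (nonempty_Icc.2 hxy)
    (fun t ht => (hd t ht).continuousAt.continuousWithinAt : ContinuousOn v (Icc x y))
  refine (hmax (left_mem_Icc.2 hxy)).trans ?_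
  by_contra! hgt
  have hzy : z < y := lt_of_le_of_ne hz.2 (by rintro rfl; linarith)
  have hslope := (hasDerivAt_iff_tendsto_slope.1 (hd z hz).hasDerivAt).mono_left
    (nhdsWithin_mono z (fun t (ht : t ∈ Ioi z) => ne_of_gt ht))
  obtain ⟨t, ht, htI⟩ := ((hslope.eventually (lt_mem_nhds (hpos z hz hgt))).and
    (Ioo_mem_nhdsGT hzy)).exists
  have hle : v t ≤ v z := hmax ⟨hz.1.trans htI.1.le, htI.2.le⟩
  rw [slope_def_field, div_pos_iff] at ht
  rcases ht with h | h
  · linarith [h.1]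
  · linarith [h.2, htI.1]

/-- Exponential boundary layer: for the singularly perturbed problem
`-ε u'' + p u' + b u = f` on `(-1,1)` with `p ≥ p₀ > 0`, `b ≥ 0`, the bound
`|(1-x) u'(x)| ≤ C` holds uniformly in `ε ∈ (0,1]`. -/
theorem stmt0 (p b f : ℝ → ℝ) (p₀ : ℝ) (hp₀ : 0 < p₀)
    (hp : ContDiffOn ℝ (⊤ : ℕ∞) p (Icc (-1 : ℝ) 1))
    (hb : ContDiffOn ℝ (⊤ : ℕ∞) b (Icc (-1 : ℝ) 1))
    (hf : ContDiffOn ℝ (⊤ : ℕ∞) f (Icc (-1 : ℝ) 1))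
    (hplb : ∀ x ∈ Icc (-1 : ℝ) 1, p₀ ≤ p x)
    (hbnn : ∀ x ∈ Icc (-1 : ℝ) 1, 0 ≤ b x)
    (uL uR : ℝ) :
    ∃ C > 0, ∀ ε ∈ Ioc (0 : ℝ) 1, ∀ u : ℝ → ℝ,
      ContDiffOn ℝ 2 u (Icc (-1 : ℝ) 1) →
      (∀ x ∈ Ioo (-1 : ℝ) 1,
        -ε * deriv (deriv u) x + p x * deriv u x + b x * u x = f x) →
      u (-1) = uL → u 1 = uR →
      ∀ x ∈ Ioo (-1 : ℝ) 1, |(1 - x) * deriv u x| ≤ C := by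
  obtain ⟨F, hF⟩ := isCompact_Icc.exists_bound_of_continuousOn hf.continuousOn
  obtain ⟨β, hβ⟩ := isCompact_Icc.exists_bound_of_continuousOn hb.continuousOn
  simp only [Real.norm_eq_abs] at hF hβ
  have h0 : (0 : ℝ) ∈ Icc (-1 : ℝ) 1 := by constructor <;> norm_num
  have hF0 : 0 ≤ F := (abs_nonneg _).trans (hF 0 h0)
  have hβ0 : 0 ≤ β := (abs_nonneg _).trans (hβ 0 h0)
  set A := |uL| + |uR| with hA
  have hA0 : 0 ≤ A := by positivity
  set B := (F + 1) / p₀ with hB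
  have hB0 : 0 ≤ B := by positivity
  have hFB : F < p₀ * B := by rw [hB, mul_div_cancel₀ _ hp₀.ne']; linarith
  set M := A + 2 * B with hM
  have hM0 : 0 ≤ M := by positivity
  set K := (F + β * M) / p₀ with hK
  have hK0 : 0 ≤ K := by positivity
  have hKp : p₀ * K = F + β * M := by rw [hK, mul_div_cancel₀ _ hp₀.ne']
  refine ⟨2 * K + 2 * M + 1, by positivity, ?_⟩
  intro ε hε u hu hode hl hr x hx
  have hsub : Ioo (-1 : ℝ) 1 ⊆ Icc (-1) 1 := Ioo_subset_Icc_self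
  have hu' : ∀ t ∈ Ioo (-1 : ℝ) 1, ContDiffAt ℝ 2 u t := fun t ht =>
    hu.contDiffAt (Icc_mem_nhds ht.1 ht.2)
  have hd : ∀ t ∈ Ioo (-1 : ℝ) 1, DifferentiableAt ℝ u t := fun t ht =>
    (hu' t ht).differentiableAt (by norm_num)
  have hdd : ∀ t ∈ Ioo (-1 : ℝ) 1, DifferentiableAt ℝ (deriv u) t := by
    intro t ht
    have h1 : ContDiffOn ℝ 1 (deriv u) (Ioo (-1) 1) :=
      (hu.mono hsub).deriv_of_isOpen isOpen_Ioo (by norm_num)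
    exact (h1.contDiffAt (Ioo_mem_nhds ht.1 ht.2)).differentiableAt (by norm_num)
  have hub : ∀ t ∈ Icc (-1 : ℝ) 1, u t ≤ M :=
    le_of_convection_diffusion_le hε.1 hplb hbnn hA0 hB0 hFB hu.continuousOn hd
      (fun t ht => (hode t ht).le.trans ((le_abs_self _).trans (hF t (hsub ht))))
      (by rw [hl]; linarith [le_abs_self uL, abs_nonneg uR])
      (by rw [hr]; linarith [le_abs_self uR, abs_nonneg uL])
  have hlb : ∀ t ∈ Icc (-1 : ℝ) 1, -u t ≤ M := by
    refine le_of_convection_diffusion_le (u := fun t => -u t) hε.1 hplb hbnn hA0 hB0 hFB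
      hu.continuousOn.neg (fun t ht => (hd t ht).neg) (fun t ht => ?_) ?_ ?_
    · simp only [deriv.fun_neg', deriv.fun_neg]
      linarith [hode t ht, neg_abs_le (f t), hF t (hsub ht)]
    · rw [hl]; linarith [neg_abs_le uL, abs_nonneg uR]
    · rw [hr]; linarith [neg_abs_le uR, abs_nonneg uL]
  have habs : ∀ t ∈ Icc (-1 : ℝ) 1, |u t| ≤ M := fun t ht =>
    abs_le.2 ⟨by linarith [hlb t ht], hub t ht⟩
  have hg : ∀ t ∈ Ioo (-1 : ℝ) 1, |f t - b t * u t| ≤ p₀ * K := by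
    intro t ht
    have h1 : |b t * u t| ≤ β * M := by
      rw [abs_mul]
      exact mul_le_mul (hβ t (hsub ht)) (habs t (hsub ht)) (abs_nonneg _) hβ0
    linarith [abs_sub (f t) (b t * u t), hF t (hsub ht)]
  obtain ⟨y, hy, hslope⟩ := exists_deriv_eq_slope u hx.2
    (hu.continuousOn.mono (Icc_subset_Icc_left hx.1.le))
    (fun t ht => (hd t ⟨hx.1.trans ht.1, ht.2⟩).differentiableWithinAt)
  have hIcc : ∀ t ∈ Icc x y, t ∈ Ioo (-1 : ℝ) 1 := fun t ht =>
    ⟨hx.1.trans_le ht.1, ht.2.trans_lt hy.2⟩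
  set m := max K |deriv u y| with hm
  have hm0 : 0 ≤ m := hK0.trans (le_max_left _ _)
  have hup : deriv u x ≤ m := by
    refine le_of_deriv_pos_of_gt hy.1.le (fun t ht => hdd t (hIcc t ht)) (fun t ht hgt => ?_)
      ((le_abs_self _).trans (le_max_right _ _))
    have hKt : K < deriv u t := (le_max_left _ _).trans_lt hgt
    have h1 := mul_le_mul_of_nonneg_right (hplb t (hsub (hIcc t ht))) (hK0.trans hKt.le)
    have h2 := mul_lt_mul_of_pos_left hKt hp₀
    have h3 := (abs_le.1 (hg t (hIcc t ht))).2
    exact pos_of_mul_pos_right (by linarith [hode t (hIcc t ht)] : 0 < ε * _) hε.1.le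
  have hlow : -deriv u x ≤ m := by
    refine le_of_deriv_pos_of_gt (v := fun t => -deriv u t) hy.1.le
      (fun t ht => (hdd t (hIcc t ht)).neg) (fun t ht hgt => ?_)
      ((neg_le_abs _).trans (le_max_right _ _))
    have hKt : K < -deriv u t := (le_max_left _ _).trans_lt hgt
    have h1 := mul_le_mul_of_nonneg_right (hplb t (hsub (hIcc t ht))) (hK0.trans hKt.le)
    have h2 := mul_lt_mul_of_pos_left hKt hp₀
    have h3 := (abs_le.1 (hg t (hIcc t ht))).1
    rw [deriv.fun_neg]
    exact pos_of_mul_pos_right (by linarith [hode t (hIcc t ht)] : 0 < ε * _) hε.1.le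
  have h1x : 0 < 1 - x := by linarith [hx.2]
  have hvy : (1 - x) * |deriv u y| ≤ 2 * M := by
    rw [hslope, abs_div, abs_of_pos h1x, mul_div_cancel₀ _ h1x.ne']
    have h1 := habs 1 (by constructor <;> norm_num)
    have h2 := habs x (hsub hx)
    linarith [abs_sub (u 1) (u x)]
  have hKx : (1 - x) * K ≤ 2 * K := mul_le_mul_of_nonneg_right (by linarith [hx.1]) hK0
  have hmle : m ≤ K + |deriv u y| := max_le_add_of_nonneg hK0 (abs_nonneg _)
  rw [abs_mul, abs_of_pos h1x]
  have := mul_le_mul_of_nonneg_left ((abs_le'.2 ⟨hup, hlow⟩).trans hmle) h1x.le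
  linarith
end

section
/- Let p, b, f : [0,1] → ℝ be infinitely differentiable with p(0) = 0, p'(0) > 0, |p'(x)| ≥ p'(0)/2 for all x ∈ [0,1], and b(x) ≥ b₀ > 0, and fix boundary values u_L, u_R ∈ ℝ. Then for each integer k ≥ 1 there exists a constant C > 0, independent of ε, such that for every ε ∈ (0,1] the (C^∞) solution u of -ε u'' + p u' + b u = f on (0,1) with u(0) = u_L, u(1) = u_R satisfies |u^{(k)}(x)| ≤ C (1 + (max{x, √ε})^{-k}) for all x ∈ [0, 1/2]. -/
open Set

theorem le_affine_of_firstOrder_le {w p : ℝ → ℝ} {ε x z g α β : ℝ} (hε : 0 < ε) (hxz : x ≤ z)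
    (hw : ∀ t ∈ Icc x z, DifferentiableAt ℝ w t)
    (heq : ∀ t ∈ Icc x z, -ε * deriv w t + p t * w t ≤ g)
    (hp : ∀ t ∈ Icc x z, 0 ≤ p t) (hβ : 0 ≤ β)
    (hwz : w z ≤ α) (hg : ∀ t ∈ Icc x z, g < ε * β + p t * α) :
    w x ≤ α + β * (z - x) := by
  have hmem : ∀ s ∈ Icc 0 (z - x), z - s ∈ Icc x z := fun s hs =>
    ⟨by linarith [hs.2], by linarith [hs.1]⟩
  have hder : ∀ s ∈ Icc 0 (z - x),
      HasDerivAt (fun s => w (z - s)) (-deriv w (z - s)) s := fun s hs =>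
    (hw _ (hmem s hs)).hasDerivAt.comp_const_sub z s
  have key := image_le_of_deriv_right_lt_deriv_boundary (a := 0) (b := z - x)
    (f := fun s => w (z - s)) (f' := fun s => -deriv w (z - s))
    (B := fun s => α + β * s) (B' := fun _ => β)
    (fun s hs => (hder s hs).continuousAt.continuousWithinAt)
    (fun s hs => (hder s (Ico_subset_Icc_self hs)).hasDerivWithinAt)
    (by simpa using hwz)
    (fun s => by simpa using ((hasDerivAt_id s).const_mul β).const_add α)
    (fun s hs hs' => by
      have hs := Ico_subset_Icc_self hs
      have h1 := heq _ (hmem s hs)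
      have h2 := hg _ (hmem s hs)
      have h3 := mul_nonneg (hp _ (hmem s hs)) (mul_nonneg hβ hs.1)
      rw [hs'] at h1
      by_contra! hcon
      nlinarith [mul_le_mul_of_nonneg_left hcon hε.le])
    (right_mem_Icc.2 (sub_nonneg.2 hxz))
  simpa using key

theorem abs_le_affine_of_firstOrder {w p : ℝ → ℝ} {ε x z g α β : ℝ} (hε : 0 < ε) (hxz : x ≤ z)
    (hw : ∀ t ∈ Icc x z, DifferentiableAt ℝ w t)
    (heq : ∀ t ∈ Icc x z, |-ε * deriv w t + p t * w t| ≤ g)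
    (hp : ∀ t ∈ Icc x z, 0 ≤ p t) (hβ : 0 ≤ β)
    (hwz : |w z| ≤ α) (hg : ∀ t ∈ Icc x z, g < ε * β + p t * α) :
    |w x| ≤ α + β * (z - x) := by
  refine abs_le'.2 ⟨le_affine_of_firstOrder_le hε hxz hw (fun t ht => (abs_le.1 (heq t ht)).2) hp hβ
    (abs_le'.1 hwz).1 hg, ?_⟩
  refine le_affine_of_firstOrder_le (w := fun t => -w t) hε hxz (fun t ht => (hw t ht).neg)
    (fun t ht => ?_) hp hβ (abs_le'.1 hwz).2 hg
  rw [deriv.fun_neg]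
  linarith [(abs_le.1 (heq t ht)).1]

theorem abs_deriv_le_of_secondOrder {v p : ℝ → ℝ} {ε c x m δ A g : ℝ}
    (hε : 0 < ε) (hc : 0 < c) (hδ : 0 < δ) (hm : 0 < m) (hg : 0 < g)
    (hv : ∀ t ∈ Icc x (x + δ * m), DifferentiableAt ℝ v t)
    (hv' : ∀ t ∈ Icc x (x + δ * m), DifferentiableAt ℝ (deriv v) t)
    (hA : ∀ t ∈ Icc x (x + δ * m), |v t| ≤ A)
    (heq : ∀ t ∈ Icc x (x + δ * m), |-ε * deriv (deriv v) t + p t * deriv v t| ≤ g)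
    (hp : ∀ t ∈ Icc x (x + δ * m), 0 ≤ p t)
    (hcase : m ^ 2 = ε ∨ ∀ t ∈ Icc x (x + δ * m), c * m ≤ p t) :
    |deriv v x| ≤ (2 * A / δ + 2 * g * (δ + 1 / c)) / m := by
  have hδm : 0 < δ * m := mul_pos hδ hm
  obtain ⟨z, hz, hzs⟩ := exists_deriv_eq_slope v (show x < x + δ * m by linarith)
    (fun t ht => (hv t ht).continuousAt.continuousWithinAt)
    (fun t ht => (hv t (Ioo_subset_Icc_self ht)).differentiableWithinAt)
  have hzb : |deriv v z| ≤ 2 * A / δ / m := by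
    rw [hzs, add_sub_cancel_left, abs_div, abs_of_pos hδm, div_div]
    gcongr
    have h1 := hA _ (left_mem_Icc.2 (by linarith : x ≤ x + δ * m))
    have h2 := hA _ (right_mem_Icc.2 (by linarith : x ≤ x + δ * m))
    linarith [abs_sub (v (x + δ * m)) (v x)]
  have hsub : ∀ t ∈ Icc x z, t ∈ Icc x (x + δ * m) := fun t ht => ⟨ht.1, ht.2.trans hz.2.le⟩
  rcases hcase with h | h
  · have := abs_le_affine_of_firstOrder (β := 2 * g / ε) hε hz.1.le
      (fun t ht => hv' t (hsub t ht)) (fun t ht => heq t (hsub t ht))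
      (fun t ht => hp t (hsub t ht)) (by positivity) hzb (fun t ht => by
        rw [mul_div_cancel₀ _ hε.ne']
        have := mul_nonneg (hp t (hsub t ht)) ((abs_nonneg _).trans hzb)
        linarith)
    have h2 : 2 * g / ε * (z - x) ≤ 2 * g / ε * (δ * m) := by
      gcongr; linarith [hz.2]
    have h3 : 2 * g / ε * (δ * m) = 2 * g * δ / m := by rw [← h]; field_simp
    have h4 : (2 * A / δ + 2 * g * (δ + 1 / c)) / m =
      2 * A / δ / m + 2 * g * δ / m + 2 * g * (1 / c) / m := by ring
    have h5 : 0 ≤ 2 * g * (1 / c) / m := by positivity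
    linarith
  · have h0 : 0 ≤ 2 * A / δ / m := (abs_nonneg _).trans hzb
    have h5 : 0 < 2 * g / c / m := by positivity
    have := abs_le_affine_of_firstOrder (β := 0) (α := 2 * A / δ / m + 2 * g / c / m) hε hz.1.le
      (fun t ht => hv' t (hsub t ht)) (fun t ht => heq t (hsub t ht))
      (fun t ht => hp t (hsub t ht)) le_rfl (by linarith) (fun t ht => by
        have h6 : c * m * (2 * g / c / m) = 2 * g := by field_simp
        have h7 := mul_le_mul_of_nonneg_right (h t (hsub t ht)) h5.le
        have := mul_nonneg (hp t (hsub t ht)) h0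
        nlinarith)
    have h4 : (2 * A / δ + 2 * g * (δ + 1 / c)) / m =
      2 * A / δ / m + 2 * g * δ / m + 2 * g / c / m := by ring
    have h6 : 0 ≤ 2 * g * δ / m := by positivity
    linarith

theorem le_of_secondOrder_le {p b f u : ℝ → ℝ} {ε b₀ M : ℝ} (hε : 0 < ε)
    (hb₀ : 0 < b₀) (hM : 0 ≤ M)
    (hb : ∀ x ∈ Ioo (0 : ℝ) 1, b₀ ≤ b x) (hf : ∀ x ∈ Ioo (0 : ℝ) 1, f x ≤ b₀ * M)
    (hu : ContinuousOn u (Icc 0 1))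
    (heq : ∀ x ∈ Ioo (0 : ℝ) 1, -ε * deriv (deriv u) x + p x * deriv u x + b x * u x = f x)
    (h0 : u 0 ≤ M) (h1 : u 1 ≤ M) : ∀ x ∈ Icc (0 : ℝ) 1, u x ≤ M := by
  obtain ⟨x, hx, hmax⟩ := isCompact_Icc.exists_isMaxOn ⟨0, left_mem_Icc.2 zero_le_one⟩ hu
  suffices u x ≤ M from fun y hy => (hmax hy).trans this
  by_contra! hcon
  have hx' : x ∈ Ioo (0 : ℝ) 1 := by
    refine ⟨lt_of_le_of_ne hx.1 ?_, lt_of_le_of_ne hx.2 ?_⟩ <;> rintro rfl <;> linarith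
  have hn := Icc_mem_nhds hx'.1 hx'.2
  have hloc : IsLocalMax u x := hmax.isLocalMax hn
  have hd : deriv u x = 0 := hloc.deriv_eq_zero
  have hdd : 0 < deriv (deriv u) x := by
    have h2 := heq x hx'
    rw [hd] at h2
    have h3 := mul_lt_mul_of_pos_left hcon hb₀
    have h4 := mul_le_mul_of_nonneg_right (hb x hx') (hM.trans hcon.le)
    have h5 := hf x hx'
    by_contra! h6
    nlinarith
  have hmin := isLocalMin_of_deriv_deriv_pos hdd hd (hu.continuousAt hn)
  have hconst : u =ᶠ[nhds x] fun _ => u x := by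
    filter_upwards [hloc, hmin] with y h1 h2 using le_antisymm h1 h2
  have : deriv (deriv u) x = 0 := by
    rw [hconst.deriv.deriv_eq]; simp
  linarith

theorem abs_le_of_secondOrder {p b f u : ℝ → ℝ} {ε b₀ M : ℝ} (hε : 0 < ε)
    (hb₀ : 0 < b₀) (hM : 0 ≤ M)
    (hb : ∀ x ∈ Ioo (0 : ℝ) 1, b₀ ≤ b x) (hf : ∀ x ∈ Ioo (0 : ℝ) 1, |f x| ≤ b₀ * M)
    (hu : ContinuousOn u (Icc 0 1))
    (heq : ∀ x ∈ Ioo (0 : ℝ) 1, -ε * deriv (deriv u) x + p x * deriv u x + b x * u x = f x)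
    (h0 : |u 0| ≤ M) (h1 : |u 1| ≤ M) : ∀ x ∈ Icc (0 : ℝ) 1, |u x| ≤ M := fun x hx => by
  refine abs_le'.2 ⟨le_of_secondOrder_le hε hb₀ hM hb (fun y hy => (abs_le'.1 (hf y hy)).1) hu heq
    (abs_le'.1 h0).1 (abs_le'.1 h1).1 x hx, ?_⟩
  refine le_of_secondOrder_le (u := fun y => -u y) (p := p) (f := fun y => -f y) hε hb₀ hM hb
    (fun y hy => (abs_le'.1 (hf y hy)).2) hu.neg (fun y hy => ?_)
    (abs_le'.1 h0).2 (abs_le'.1 h1).2 x hx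
  rw [show deriv (fun y => -u y) = fun y => -deriv u y from funext fun y => deriv.fun_neg,
    deriv.fun_neg, ← heq y hy]
  ring

theorem abs_deriv_le_of_forall_right {h : ℝ → ℝ} {a d K : ℝ} (hd : a < d) (hK : 0 ≤ K)
    (hdiff : ∀ x ∈ Ioo a d, DifferentiableAt ℝ h x)
    (hb : ∀ x ∈ Ioo a d, |deriv h x| ≤ K) : |deriv h a| ≤ K := by
  by_cases ha : DifferentiableAt ℝ h a
  swap
  · rwa [deriv_zero_of_not_differentiableAt ha, abs_zero]
  have hs := (hasDerivWithinAt_iff_tendsto_slope' (s := Ioi a) (by simp)).1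
    ha.hasDerivAt.hasDerivWithinAt
  refine le_of_tendsto hs.abs ?_
  filter_upwards [Ioo_mem_nhdsGT hd] with y hy
  obtain ⟨z, hz, hzs⟩ := exists_deriv_eq_slope h hy.1
    (fun t ht => by
      rcases ht.1.eq_or_lt with rfl | hlt
      · exact ha.continuousAt.continuousWithinAt
      · exact (hdiff t ⟨hlt, ht.2.trans_lt hy.2⟩).continuousAt.continuousWithinAt)
    (fun t ht => (hdiff t ⟨ht.1, ht.2.trans hy.2⟩).differentiableWithinAt)
  rw [slope_def_field, ← hzs]
  exact hb z ⟨hz.1, hz.2.trans hy.2⟩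

theorem exists_abs_iteratedDeriv_le {h : ℝ → ℝ} (hh : ContDiffOn ℝ (⊤ : ℕ∞) h (Icc (0 : ℝ) 1))
    (j : ℕ) : ∃ K, 0 ≤ K ∧ ∀ x ∈ Ioo (0 : ℝ) 1, |iteratedDeriv j h x| ≤ K := by
  obtain ⟨K, hK⟩ := isCompact_Icc.exists_bound_of_continuousOn
    (hh.continuousOn_iteratedDerivWithin (m := j) (by exact_mod_cast le_top)
      (uniqueDiffOn_Icc zero_lt_one))
  refine ⟨K, (norm_nonneg _).trans (hK 0 (left_mem_Icc.2 zero_le_one)), fun x hx => ?_⟩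
  rw [← iteratedDerivWithin_eq_iteratedDeriv (uniqueDiffOn_Icc zero_lt_one)
    ((hh.contDiffAt (Icc_mem_nhds hx.1 hx.2)).of_le (by exact_mod_cast le_top))
    (Ioo_subset_Icc_self hx)]
  exact hK x (Ioo_subset_Icc_self hx)

theorem ContDiffOn.differentiableAt_iteratedDeriv {h : ℝ → ℝ} {s : Set ℝ} (hs : IsOpen s)
    (hh : ContDiffOn ℝ (⊤ : ℕ∞) h s) (j : ℕ) {x : ℝ} (hx : x ∈ s) :
    DifferentiableAt ℝ (iteratedDeriv j h) x := by
  refine DifferentiableOn.differentiableAt ?_ (hs.mem_nhds hx)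
  exact (hh.differentiableOn_iteratedDerivWithin (m := j) (by exact_mod_cast WithTop.coe_lt_top j)
    hs.uniqueDiffOn).congr fun y hy => (iteratedDerivWithin_of_isOpen hs hy).symm

theorem iteratedDeriv_of_secondOrder {p b f u : ℝ → ℝ} {s : Set ℝ} {ε : ℝ} (hs : IsOpen s)
    (hp : ContDiffOn ℝ (⊤ : ℕ∞) p s) (hb : ContDiffOn ℝ (⊤ : ℕ∞) b s)
    (hu : ContDiffOn ℝ (⊤ : ℕ∞) u s)
    (heq : ∀ x ∈ s, -ε * deriv (deriv u) x + p x * deriv u x + b x * u x = f x)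
    (k : ℕ) {x : ℝ} (hx : x ∈ s) :
    -ε * iteratedDeriv (k + 2) u x + p x * iteratedDeriv (k + 1) u x =
      iteratedDeriv k f x
      - ∑ i ∈ Finset.range (k + 1), k.choose i * iteratedDeriv i b x * iteratedDeriv (k - i) u x
      - ∑ i ∈ Finset.range k,
          k.choose (i + 1) * iteratedDeriv (i + 1) p x * iteratedDeriv (k - i) u x := by
  have hle : (k : WithTop ℕ∞) ≤ ((⊤ : ℕ∞) : WithTop ℕ∞) := by exact_mod_cast le_top
  have hu1 := hu.deriv_of_isOpen (m := (⊤ : ℕ∞)) hs (by rfl)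
  have hu2 := hu1.deriv_of_isOpen (m := (⊤ : ℕ∞)) hs (by rfl)
  have at' {h : ℝ → ℝ} (hh : ContDiffOn ℝ (⊤ : ℕ∞) h s) : ContDiffAt ℝ k h x :=
    (hh.contDiffAt (hs.mem_nhds hx)).of_le hle
  have hE : EqOn f ((fun y => -ε * deriv (deriv u) y) + p * deriv u + b * u) s :=
    fun y hy => (heq y hy).symm
  have h1 := hE.iteratedDeriv_of_isOpen hs k hx
  have c1 : ContDiffAt ℝ k (fun y => -ε * deriv (deriv u) y) x := contDiffAt_const.mul (at' hu2)
  have c2 : ContDiffAt ℝ k (p * deriv u) x := (at' hp).mul (at' hu1)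
  have c3 : ContDiffAt ℝ k (b * u) x := (at' hb).mul (at' hu)
  have c12 : ContDiffAt ℝ k ((fun y => -ε * deriv (deriv u) y) + p * deriv u) x := c1.add c2
  rw [iteratedDeriv_add c12 c3, iteratedDeriv_add c1 c2, iteratedDeriv_const_mul_field,
    iteratedDeriv_mul (at' hp) (at' hu1), iteratedDeriv_mul (at' hb) (at' hu),
    Finset.sum_range_succ'] at h1
  rw [h1]
  simp only [← iteratedDeriv_succ', Nat.choose_zero_right, iteratedDeriv_zero, Nat.sub_zero]
  have : ∀ i ∈ Finset.range k, (k.choose (i + 1) : ℝ) * iteratedDeriv (i + 1) p x *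
      iteratedDeriv (k - (i + 1) + 1) u x =
      k.choose (i + 1) * iteratedDeriv (i + 1) p x * iteratedDeriv (k - i) u x := fun i hi => by
    rw [show k - (i + 1) + 1 = k - i by have := Finset.mem_range.1 hi; omega]
  rw [Finset.sum_congr rfl this]
  push_cast
  ring

theorem exists_slope_mul_le {p : ℝ → ℝ} (hp : ContinuousOn p (Icc (0 : ℝ) 1)) (hp0 : p 0 = 0)
    (hp'0 : 0 < deriv p 0) (hp'lb : ∀ x ∈ Icc (0 : ℝ) 1, deriv p 0 / 2 ≤ |deriv p x|) :
    ∃ c > 0, ∀ x ∈ Icc (0 : ℝ) 1, c * x ≤ p x := by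
  have hne : ∀ x ∈ Icc (0 : ℝ) 1, deriv p x ≠ 0 := fun x hx h => by
    have := hp'lb x hx
    rw [h, abs_zero] at this
    linarith
  have h0 : (0 : ℝ) ∈ Icc (0 : ℝ) 1 := left_mem_Icc.2 zero_le_one
  have hpos : ∀ x ∈ Icc (0 : ℝ) 1, 0 < deriv p x := by
    refine (hasDerivWithinAt_forall_lt_or_forall_gt_of_forall_ne (convex_Icc 0 1)
      (fun x hx => (differentiableAt_of_deriv_ne_zero (hne x hx)).hasDerivAt.hasDerivWithinAt)
      hne).resolve_left fun h => ?_
    exact lt_asymm (h 0 h0) hp'0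
  refine ⟨deriv p 0 / 2, by linarith, fun x hx => ?_⟩
  have := (convex_Icc (0 : ℝ) 1).mul_sub_le_image_sub_of_le_deriv hp
    (fun y hy => (differentiableAt_of_deriv_ne_zero
      (hne y (interior_subset hy))).differentiableWithinAt)
    (fun y hy => by
      have hy := interior_subset hy
      simpa [abs_of_pos (hpos y hy)] using hp'lb y hy) 0 h0 x hx hx.1
  simpa [hp0] using this

theorem exists_abs_iteratedDeriv_le_div_pow {p b f : ℝ → ℝ} {b₀ c : ℝ} (hb₀ : 0 < b₀) (hc : 0 < c)
    (hp : ContDiffOn ℝ (⊤ : ℕ∞) p (Icc (0 : ℝ) 1))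
    (hb : ContDiffOn ℝ (⊤ : ℕ∞) b (Icc (0 : ℝ) 1))
    (hf : ContDiffOn ℝ (⊤ : ℕ∞) f (Icc (0 : ℝ) 1))
    (hplb : ∀ x ∈ Icc (0 : ℝ) 1, c * x ≤ p x)
    (hblb : ∀ x ∈ Icc (0 : ℝ) 1, b₀ ≤ b x)
    (uL uR : ℝ) (k : ℕ) : ∀ θ < (1 : ℝ), ∃ C > 0, ∀ ε ∈ Ioc (0 : ℝ) 1, ∀ u : ℝ → ℝ,
      ContDiffOn ℝ (⊤ : ℕ∞) u (Icc (0 : ℝ) 1) →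
      (∀ x ∈ Ioo (0 : ℝ) 1,
        -ε * deriv (deriv u) x + p x * deriv u x + b x * u x = f x) →
      u 0 = uL → u 1 = uR →
      ∀ x ∈ Ioc (0 : ℝ) θ, ∀ j ≤ k,
        |iteratedDeriv j u x| ≤ C / max x (Real.sqrt ε) ^ j := by
  choose Kp hKp0 hKp using exists_abs_iteratedDeriv_le hp
  choose Kb hKb0 hKb using exists_abs_iteratedDeriv_le hb
  choose Kf hKf0 hKf using exists_abs_iteratedDeriv_le hf
  induction k with
  | zero =>
    intro θ hθ
    have hf0 := hKf 0
    simp only [iteratedDeriv_zero] at hf0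
    have hq : 0 ≤ Kf 0 / b₀ := div_nonneg (hKf0 0) hb₀.le
    have hM0 : 0 ≤ |uL| + |uR| + Kf 0 / b₀ := by positivity
    refine ⟨|uL| + |uR| + Kf 0 / b₀ + 1, by linarith, ?_⟩
    rintro ε hε u hu heq rfl rfl x hx j hj
    obtain rfl : j = 0 := by omega
    rw [pow_zero, div_one, iteratedDeriv_zero]
    have hL := abs_nonneg (u 0)
    have hR := abs_nonneg (u 1)
    refine (abs_le_of_secondOrder hε.1 hb₀ hM0 (fun y hy => hblb y (Ioo_subset_Icc_self hy))
      (fun y hy => (hf0 y hy).trans ?_) hu.continuousOn heq (by linarith) (by linarith) x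
      ⟨hx.1.le, hx.2.trans hθ.le⟩).trans (by linarith)
    have : Kf 0 = b₀ * (Kf 0 / b₀) := by field_simp
    rw [mul_add, ← this]
    have := mul_nonneg hb₀.le (add_nonneg hL hR)
    linarith
  | succ k ih =>
    intro θ hθ
    obtain ⟨C, hC, ihC⟩ := ih (θ + (1 - θ) / 2) (by linarith)
    set δ := (1 - θ) / 2 with hδdef
    have hδ : 0 < δ := by linarith
    set g := Kf k + ∑ i ∈ Finset.range (k + 1), k.choose i * Kb i * C
      + ∑ i ∈ Finset.range k, k.choose (i + 1) * Kp (i + 1) * C + 1 with hgdef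
    have hg : 0 < g := by
      have h1 : 0 ≤ ∑ i ∈ Finset.range (k + 1), k.choose i * Kb i * C :=
        Finset.sum_nonneg fun i _ => mul_nonneg (mul_nonneg (Nat.cast_nonneg _) (hKb0 i)) hC.le
      have h2 : 0 ≤ ∑ i ∈ Finset.range k, k.choose (i + 1) * Kp (i + 1) * C :=
        Finset.sum_nonneg fun i _ =>
          mul_nonneg (mul_nonneg (Nat.cast_nonneg _) (hKp0 (i + 1))) hC.le
      linarith [hKf0 k]
    refine ⟨max C (2 * C / δ + 2 * g * (δ + 1 / c)), lt_max_of_lt_left hC, ?_⟩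
    intro ε hε u hu heq hu0 hu1 x hx j hj
    have hsε := Real.sqrt_pos.2 hε.1
    have hsε1 : Real.sqrt ε ≤ 1 := Real.sqrt_le_one.2 hε.2
    specialize ihC ε hε u hu heq hu0 hu1
    set m := max x (Real.sqrt ε) with hmdef
    have hm : 0 < m := lt_max_of_lt_right hsε
    have hm1 : m ≤ 1 := max_le (hx.2.trans hθ.le) hsε1
    have hxδ : x + δ * m ≤ θ + δ := by nlinarith [hx.2]
    rcases Nat.lt_or_eq_of_le hj with hj | rfl
    · refine (ihC x ⟨hx.1, by linarith [hx.2]⟩ j (by omega)).trans ?_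
      gcongr
      exact le_max_left _ _
    have hmem : ∀ t ∈ Icc x (x + δ * m), t ∈ Ioc 0 (θ + δ) := fun t ht =>
      ⟨hx.1.trans_le ht.1, ht.2.trans hxδ⟩
    have hmem1 : ∀ t ∈ Icc x (x + δ * m), t ∈ Ioo (0 : ℝ) 1 := fun t ht =>
      ⟨(hmem t ht).1, (hmem t ht).2.trans_lt (by linarith)⟩
    have hbd : ∀ t ∈ Icc x (x + δ * m), ∀ j ≤ k, |iteratedDeriv j u t| ≤ C / m ^ k := by
      intro t ht j hj
      have hmt : m ≤ max t (Real.sqrt ε) := max_le_max_right _ ht.1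
      refine (ihC t (hmem t ht) j hj).trans ?_
      refine div_le_div_of_nonneg_left hC.le (pow_pos hm k) ?_
      exact (pow_le_pow_of_le_one hm.le hm1 hj).trans (pow_le_pow_left₀ hm.le hmt j)
    have huo := hu.mono Ioo_subset_Icc_self
    have hmk : 0 < m ^ k := pow_pos hm k
    have key := abs_deriv_le_of_secondOrder (v := iteratedDeriv k u) (p := p) (ε := ε) (c := c)
      (x := x) (m := m) (δ := δ) (A := C / m ^ k) (g := g / m ^ k) hε.1 hc hδ hm (by positivity)
      (fun t ht => huo.differentiableAt_iteratedDeriv isOpen_Ioo k (hmem1 t ht))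
      (fun t ht => by
        rw [← iteratedDeriv_succ]
        exact huo.differentiableAt_iteratedDeriv isOpen_Ioo (k + 1) (hmem1 t ht))
      (fun t ht => hbd t ht k le_rfl)
      (fun t ht => by
        rw [← iteratedDeriv_succ, ← iteratedDeriv_succ,
          iteratedDeriv_of_secondOrder isOpen_Ioo (hp.mono Ioo_subset_Icc_self)
            (hb.mono Ioo_subset_Icc_self) huo heq k (hmem1 t ht)]
        have e1 : |iteratedDeriv k f t| ≤ Kf k / m ^ k :=
          (hKf k t (hmem1 t ht)).trans
            (le_div_self (hKf0 k) hmk (pow_le_one₀ hm.le hm1))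
        have e2 : |∑ i ∈ Finset.range (k + 1),
            k.choose i * iteratedDeriv i b t * iteratedDeriv (k - i) u t| ≤
            (∑ i ∈ Finset.range (k + 1), k.choose i * Kb i * C) / m ^ k := by
          rw [Finset.sum_div]
          refine (Finset.abs_sum_le_sum_abs _ _).trans (Finset.sum_le_sum fun i _ => ?_)
          rw [abs_mul, abs_mul, Nat.abs_cast, mul_div_assoc]
          gcongr
          · exact mul_nonneg (Nat.cast_nonneg _) (hKb0 i)
          · exact hKb i t (hmem1 t ht)
          · exact hbd t ht _ (Nat.sub_le _ _)
        have e3 : |∑ i ∈ Finset.range k,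
            k.choose (i + 1) * iteratedDeriv (i + 1) p t * iteratedDeriv (k - i) u t| ≤
            (∑ i ∈ Finset.range k, k.choose (i + 1) * Kp (i + 1) * C) / m ^ k := by
          rw [Finset.sum_div]
          refine (Finset.abs_sum_le_sum_abs _ _).trans (Finset.sum_le_sum fun i _ => ?_)
          rw [abs_mul, abs_mul, Nat.abs_cast, mul_div_assoc]
          gcongr
          · exact mul_nonneg (Nat.cast_nonneg _) (hKp0 (i + 1))
          · exact hKp (i + 1) t (hmem1 t ht)
          · exact hbd t ht _ (Nat.sub_le _ _)
        refine (abs_sub _ _).trans ((add_le_add_left (abs_sub _ _) _).trans ?_)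
        rw [hgdef, add_div, add_div, add_div]
        have : 0 ≤ 1 / m ^ k := by positivity
        linarith)
      (fun t ht => (mul_nonneg hc.le (hmem1 t ht).1.le).trans
        (hplb t (Ioo_subset_Icc_self (hmem1 t ht))))
      (by
        rcases le_total x (Real.sqrt ε) with h | h
        · left
          rw [hmdef, max_eq_right h, Real.sq_sqrt hε.1.le]
        · right
          intro t ht
          have hmx : m = x := max_eq_left h
          refine le_trans ?_ (hplb t (Ioo_subset_Icc_self (hmem1 t ht)))
          rw [hmx]
          exact mul_le_mul_of_nonneg_left ht.1 hc.le)
    rw [iteratedDeriv_succ]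
    refine key.trans ?_
    have : (2 * (C / m ^ k) / δ + 2 * (g / m ^ k) * (δ + 1 / c)) / m =
        (2 * C / δ + 2 * g * (δ + 1 / c)) / m ^ (k + 1) := by
      rw [pow_succ]
      field_simp
    rw [this]
    gcongr
    exact le_max_right _ _

/-- Lemma 2.2 (compact form): for the single boundary turning point problem with
`p'(0) > 0`, the `k`-th derivative of the solution satisfies
`|u^{(k)}(x)| ≤ C (1 + max{x, √ε}^{-k})` on `[0, 1/2]`, uniformly in `ε ∈ (0,1]`. -/
theorem stmt3 (p b f : ℝ → ℝ) (b₀ : ℝ) (hb₀ : 0 < b₀)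
    (hp : ContDiffOn ℝ (⊤ : ℕ∞) p (Icc (0 : ℝ) 1))
    (hb : ContDiffOn ℝ (⊤ : ℕ∞) b (Icc (0 : ℝ) 1))
    (hf : ContDiffOn ℝ (⊤ : ℕ∞) f (Icc (0 : ℝ) 1))
    (hp0 : p 0 = 0) (hp'0 : 0 < deriv p 0)
    (hp'lb : ∀ x ∈ Icc (0 : ℝ) 1, deriv p 0 / 2 ≤ |deriv p x|)
    (hblb : ∀ x ∈ Icc (0 : ℝ) 1, b₀ ≤ b x)
    (uL uR : ℝ) (k : ℕ) (hk : 1 ≤ k) :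
    ∃ C > 0, ∀ ε ∈ Ioc (0 : ℝ) 1, ∀ u : ℝ → ℝ,
      ContDiffOn ℝ (⊤ : ℕ∞) u (Icc (0 : ℝ) 1) →
      (∀ x ∈ Ioo (0 : ℝ) 1,
        -ε * deriv (deriv u) x + p x * deriv u x + b x * u x = f x) →
      u 0 = uL → u 1 = uR →
      ∀ x ∈ Icc (0 : ℝ) (1 / 2),
        |iteratedDeriv k u x| ≤ C * (1 + (max x (Real.sqrt ε)) ^ (-(k : ℤ))) := by
  obtain ⟨c, hc, hplb⟩ := exists_slope_mul_le hp.continuousOn hp0 hp'0 hp'lb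
  obtain ⟨C, hC, H⟩ := exists_abs_iteratedDeriv_le_div_pow hb₀ hc hp hb hf hplb hblb uL uR k
    (1 / 2) (by norm_num)
  refine ⟨C, hC, fun ε hε u hu heq hu0 hu1 x hx => ?_⟩
  have hsε := Real.sqrt_pos.2 hε.1
  specialize H ε hε u hu heq hu0 hu1
  suffices |iteratedDeriv k u x| ≤ C / max x (Real.sqrt ε) ^ k by
    refine this.trans ?_
    rw [zpow_neg, zpow_natCast, div_eq_mul_inv]
    gcongr
    linarith
  rcases hx.1.eq_or_lt with rfl | hx0
  swap
  · exact H x ⟨hx0, hx.2⟩ k le_rfl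
  obtain ⟨n, rfl⟩ := Nat.exists_eq_add_of_le' hk
  rw [iteratedDeriv_succ]
  refine abs_deriv_le_of_forall_right (d := 1 / 2) (by norm_num) (by positivity)
    (fun y hy => (hu.mono Ioo_subset_Icc_self).differentiableAt_iteratedDeriv isOpen_Ioo n
      ⟨hy.1, hy.2.trans (by norm_num)⟩) fun y hy => ?_
  rw [← iteratedDeriv_succ]
  refine (H y ⟨hy.1, hy.2.le⟩ (n + 1) le_rfl).trans ?_
  gcongr
  exact hy.1.le
end

section
/- Let p, b, f : [0,1] → ℝ be infinitely differentiable with p(0) = 0, p'(0) > 0, |p'(x)| ≥ p'(0)/2 for all x ∈ [0,1], and b(x) ≥ b₀ > 0, and fix boundary values u_L, u_R ∈ ℝ. Then for each integer k ≥ 1 there exists a constant C > 0, independent of ε, such that for every ε ∈ (0,1] the (C^∞) solution u of -ε u'' + p u' + b u = f on (0,1) with u(0) = u_L, u(1) = u_R satisfies |u^{(k)}(x)| ≤ C (1 + (max{x, √ε})^{-k} + (1-x)^{-k}) for all x ∈ (0, 1). -/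
open Set

namespace TurningPoint

open Filter Topology

/-- The derivative is nonpositive at a point from which the function does not increase
to the right. -/
lemma hasDerivAt_nonpos_of_le_right {ψ : ℝ → ℝ} {ψ' z y : ℝ} (hzy : z < y)
    (hd : HasDerivAt ψ ψ' z) (hmax : ∀ s ∈ Ioc z y, ψ s ≤ ψ z) : ψ' ≤ 0 := by
  have h := (hasDerivWithinAt_iff_tendsto_slope' (s := Ioi z) (by simp)).1 hd.hasDerivWithinAt
  refine le_of_tendsto h ?_
  filter_upwards [Ioc_mem_nhdsGT hzy] with s hs
  rw [slope_def_field]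
  exact div_nonpos_of_nonpos_of_nonneg (by linarith [hmax s hs]) (by linarith [hs.1])

/-- Comparison principle for `ε w' = p w + g` with data prescribed at the right end point. -/
lemma le_barrier {ε x y : ℝ} (hε : 0 < ε) (hxy : x ≤ y) {p g w w' φ φ' : ℝ → ℝ}
    (hp : ∀ s ∈ Icc x y, 0 < p s)
    (hw : ∀ s ∈ Icc x y, HasDerivAt w (w' s) s)
    (hφ : ∀ s ∈ Icc x y, HasDerivAt φ (φ' s) s)
    (heq : ∀ s ∈ Icc x y, ε * w' s = p s * w s + g s)
    (hbar : ∀ s ∈ Icc x y, -g s ≤ p s * φ s - ε * φ' s) (hφy : 0 ≤ φ y) :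
    w x ≤ φ x + |w y| := by
  have hd : ∀ s ∈ Icc x y, HasDerivAt (fun t => w t - φ t) (w' s - φ' s) s :=
    fun s hs => (hw s hs).sub (hφ s hs)
  obtain ⟨z, hz, hmax⟩ := isCompact_Icc.exists_isMaxOn (nonempty_Icc.2 hxy)
    (fun s hs => (hd s hs).continuousAt.continuousWithinAt)
  have hmax' : ∀ s ∈ Icc x y, w s - φ s ≤ w z - φ z := fun s hs => hmax hs
  have hx := hmax' x ⟨le_rfl, hxy⟩
  rcases eq_or_lt_of_le hz.2 with rfl | hzy
  · linarith [le_abs_self (w z)]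
  · have h1 := hasDerivAt_nonpos_of_le_right hzy (hd z hz)
      (fun s hs => hmax' s ⟨hz.1.trans hs.1.le, hs.2⟩)
    have h2 : p z * (w z - φ z) ≤ 0 := by
      nlinarith [heq z hz, hbar z hz, mul_nonneg hε.le (neg_nonneg.2 h1)]
    have h3 : w z - φ z ≤ 0 := by
      by_contra! h
      linarith [mul_pos (hp z hz) h]
    linarith [abs_nonneg (w y)]

/-- Two-sided form of `le_barrier`. -/
lemma abs_le_barrier {ε x y H : ℝ} (hε : 0 < ε) (hxy : x ≤ y) {p g w w' φ φ' : ℝ → ℝ}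
    (hp : ∀ s ∈ Icc x y, 0 < p s)
    (hw : ∀ s ∈ Icc x y, HasDerivAt w (w' s) s)
    (hφ : ∀ s ∈ Icc x y, HasDerivAt φ (φ' s) s)
    (heq : ∀ s ∈ Icc x y, ε * w' s = p s * w s + g s)
    (hg : ∀ s ∈ Icc x y, |g s| ≤ H)
    (hbar : ∀ s ∈ Icc x y, H ≤ p s * φ s - ε * φ' s) (hφy : 0 ≤ φ y) :
    |w x| ≤ φ x + |w y| := by
  rw [abs_le']
  constructor
  · exact le_barrier hε hxy hp hw hφ heq
      (fun s hs => by linarith [neg_abs_le (g s), hg s hs, hbar s hs]) hφy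
  · have := le_barrier (w := fun s => -w s) (w' := fun s => -w' s) (g := fun s => -g s)
      hε hxy hp (fun s hs => (hw s hs).neg) hφ (fun s hs => by linarith [heq s hs])
      (fun s hs => by linarith [le_abs_self (g s), hg s hs, hbar s hs]) hφy
    simpa using this

/-- The local length scale of the turning point problem. -/
noncomputable def scale (ε x : ℝ) : ℝ := min (max x (Real.sqrt ε)) (1 - x)

lemma scale_pos {ε x : ℝ} (hx : x ∈ Ioo (0 : ℝ) 1) : 0 < scale ε x :=
  lt_min (lt_max_of_lt_left hx.1) (by linarith [hx.2])

lemma scale_le_one {ε x : ℝ} (hx : x ∈ Ioo (0 : ℝ) 1) : scale ε x ≤ 1 :=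
  (min_le_right _ _).trans (by linarith [hx.1])

lemma half_scale_le {ε x s : ℝ} (hx : x ∈ Ioo (0 : ℝ) 1) (hs : s ∈ Icc x (x + scale ε x / 2)) :
    scale ε x / 2 ≤ scale ε s := by
  have h0 := scale_pos (ε := ε) hx
  have h1 : scale ε x ≤ max x (Real.sqrt ε) := min_le_left _ _
  have h2 : scale ε x ≤ 1 - x := min_le_right _ _
  have h3 : max x (Real.sqrt ε) ≤ max s (Real.sqrt ε) := max_le_max_right _ hs.1
  exact le_min (by linarith) (by linarith [hs.2])

lemma div_scale_pow_le {ε x s A : ℝ} (hA : 0 ≤ A) (n : ℕ) (hx : x ∈ Ioo (0 : ℝ) 1)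
    (hs : s ∈ Icc x (x + scale ε x / 2)) :
    A / scale ε s ^ n ≤ 2 ^ n * A / scale ε x ^ n := by
  have h0 := scale_pos (ε := ε) hx
  calc A / scale ε s ^ n ≤ A / (scale ε x / 2) ^ n := by
        have := half_scale_le hx hs
        gcongr
    _ = 2 ^ n * A / scale ε x ^ n := by
        rw [div_pow]; field_simp

/-- Bounds on `v` and on `ε v'' - p v'` in terms of the local length scale bound `v'`. -/
lemma abs_deriv_le {ε α A B : ℝ} (n : ℕ) (hε : 0 < ε) (hα : 0 < α) (hA : 0 ≤ A) (hB : 0 ≤ B)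
    {p v v₁ v₂ g : ℝ → ℝ}
    (hp : ∀ x ∈ Ioo (0 : ℝ) 1, α * x ≤ p x)
    (hv : ∀ x ∈ Ioo (0 : ℝ) 1, HasDerivAt v (v₁ x) x)
    (hv₁ : ∀ x ∈ Ioo (0 : ℝ) 1, HasDerivAt v₁ (v₂ x) x)
    (heq : ∀ x ∈ Ioo (0 : ℝ) 1, ε * v₂ x = p x * v₁ x + g x)
    (hvA : ∀ x ∈ Ioo (0 : ℝ) 1, |v x| ≤ A / scale ε x ^ n)
    (hgB : ∀ x ∈ Ioo (0 : ℝ) 1, |g x| ≤ B / scale ε x ^ n) :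
    ∀ x ∈ Ioo (0 : ℝ) 1,
      |v₁ x| ≤ (4 * (2 ^ n * A) + 2 ^ n * B * (1 / α + 1)) / scale ε x ^ (n + 1) := by
  intro x hx
  have hd := scale_pos (ε := ε) hx
  have hdx : scale ε x ≤ 1 - x := min_le_right _ _
  have hdm : scale ε x ≤ max x (Real.sqrt ε) := min_le_left _ _
  have hmem : ∀ s ∈ Icc x (x + scale ε x / 2), s ∈ Ioo (0 : ℝ) 1 := fun s hs =>
    ⟨hx.1.trans_le hs.1, by linarith [hs.2, hx.2]⟩
  have hdiv := fun s hs {A} (hA : 0 ≤ A) => div_scale_pow_le (ε := ε) (s := s) hA n hx hs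
  set d := scale ε x with hd_def
  have hxe : x < x + d / 2 := by linarith
  obtain ⟨y, hy, hvy⟩ := exists_hasDerivAt_eq_slope v v₁ hxe
    (fun s hs => (hv s (hmem s hs)).continuousAt.continuousWithinAt)
    (fun s hs => hv s (hmem s ⟨hs.1.le, hs.2.le⟩))
  have hv_le : ∀ s ∈ Icc x (x + d / 2), |v s| ≤ 2 ^ n * A / d ^ n := fun s hs =>
    (hvA s (hmem s hs)).trans (hdiv s hs hA)
  have hv₁y : |v₁ y| ≤ 4 * (2 ^ n * A) / d ^ (n + 1) := by
    rw [hvy, abs_div, abs_of_pos (show 0 < x + d / 2 - x by linarith), div_le_iff₀ (by linarith)]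
    calc |v (x + d / 2) - v x| ≤ |v (x + d / 2)| + |v x| := abs_sub _ _
      _ ≤ 2 ^ n * A / d ^ n + 2 ^ n * A / d ^ n :=
          add_le_add (hv_le _ ⟨hxe.le, le_rfl⟩) (hv_le _ ⟨le_rfl, hxe.le⟩)
      _ = 4 * (2 ^ n * A) / d ^ (n + 1) * (x + d / 2 - x) := by
          rw [pow_succ]; field_simp; ring
  set H := 2 ^ n * B / d ^ n with hH
  have hH0 : 0 ≤ H := by positivity
  have hsub : ∀ s ∈ Icc x y, s ∈ Icc x (x + d / 2) := fun s hs => ⟨hs.1, hs.2.trans hy.2.le⟩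
  have hg : ∀ s ∈ Icc x y, |g s| ≤ H := fun s hs =>
    (hgB s (hmem s (hsub s hs))).trans (hdiv s (hsub s hs) hB)
  have hpx : ∀ s ∈ Icc x y, α * x ≤ p s := fun s hs =>
    (mul_le_mul_of_nonneg_left hs.1 hα.le).trans (hp s (hmem s (hsub s hs)))
  have hpos : 0 < α * x := mul_pos hα hx.1
  have hp0 : ∀ s ∈ Icc x y, 0 < p s := fun s hs => hpos.trans_le (hpx s hs)
  have key : |v₁ x| ≤ H * (1 / α + 1) / d + |v₁ y| := by
    rcases le_or_gt (Real.sqrt ε) x with hc | hc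
    · have hdx' : d ≤ x := by rwa [max_eq_left hc] at hdm
      have h := abs_le_barrier (φ := fun _ => H / (α * x)) (φ' := fun _ => 0) hε hy.1.le hp0
        (fun s hs => hv₁ s (hmem s (hsub s hs))) (fun s _ => hasDerivAt_const s _)
        (fun s hs => heq s (hmem s (hsub s hs))) hg
        (fun s hs => by
          have : α * x * (H / (α * x)) = H := mul_div_cancel₀ H hpos.ne'
          have h2 := mul_le_mul_of_nonneg_right (hpx s hs) (show 0 ≤ H / (α * x) by positivity)
          linarith) (by positivity)
      have : H / (α * x) ≤ H * (1 / α + 1) / d := by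
        calc H / (α * x) ≤ H / (α * d) := by gcongr
          _ = H * (1 / α) / d := by field_simp
          _ ≤ _ := by gcongr; linarith
      linarith
    · have hdx' : d ≤ Real.sqrt ε := by rwa [max_eq_right hc.le] at hdm
      have hdd : d * d ≤ ε := by
        calc d * d ≤ Real.sqrt ε * Real.sqrt ε := by gcongr
          _ = ε := Real.mul_self_sqrt hε.le
      have h := abs_le_barrier (φ := fun s => H * (y - s) / ε) (φ' := fun _ => H * (-1) / ε)
        hε hy.1.le hp0
        (fun s hs => hv₁ s (hmem s (hsub s hs)))
        (fun s _ => (((hasDerivAt_id s).const_sub y).const_mul H).div_const ε)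
        (fun s hs => heq s (hmem s (hsub s hs))) hg
        (fun s hs => by
          have h1 : ε * (H * (-1) / ε) = -H := by field_simp
          have h2 : 0 ≤ p s * (H * (y - s) / ε) :=
            mul_nonneg (hp0 s hs).le (div_nonneg (mul_nonneg hH0 (by linarith [hs.2])) hε.le)
          linarith) (by simp)
      have : H * (y - x) / ε ≤ H * (1 / α + 1) / d := by
        rw [div_le_div_iff₀ hε hd]
        have h1 : (y - x) * d ≤ (1 / α + 1) * ε := by
          have : 0 ≤ 1 / α * ε := by positivity
          nlinarith [hy.2]
        nlinarith [mul_le_mul_of_nonneg_left h1 hH0]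
      linarith
  calc |v₁ x| ≤ H * (1 / α + 1) / d + 4 * (2 ^ n * A) / d ^ (n + 1) := by linarith
    _ = _ := by rw [hH, pow_succ]; field_simp; ring

/-- The differential equation on the open interval, together with smoothness up to the boundary. -/
def IsSol (p b f : ℝ → ℝ) (ε : ℝ) (u : ℝ → ℝ) : Prop :=
  ContDiffOn ℝ (⊤ : ℕ∞) u (Icc (0 : ℝ) 1) ∧
    ∀ x ∈ Ioo (0 : ℝ) 1, -ε * deriv (deriv u) x + p x * deriv u x + b x * u x = f x

lemma _root_.ContDiffOn.hasDerivAt_derivWithin {c : ℝ → ℝ}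
    (hc : ContDiffOn ℝ (⊤ : ℕ∞) c (Icc (0 : ℝ) 1)) {x : ℝ} (hx : x ∈ Ioo (0 : ℝ) 1) :
    HasDerivAt c (derivWithin c (Icc 0 1) x) x :=
  ((hc.differentiableOn (by simp) x (Ioo_subset_Icc_self hx)).hasDerivWithinAt).hasDerivAt
    (Icc_mem_nhds hx.1 hx.2)

lemma _root_.ContDiffOn.derivWithin_Icc {c : ℝ → ℝ}
    (hc : ContDiffOn ℝ (⊤ : ℕ∞) c (Icc (0 : ℝ) 1)) :
    ContDiffOn ℝ (⊤ : ℕ∞) (derivWithin c (Icc 0 1)) (Icc (0 : ℝ) 1) :=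
  hc.derivWithin (uniqueDiffOn_Icc zero_lt_one) (by simp)

lemma _root_.ContDiffOn.exists_abs_le {c : ℝ → ℝ}
    (hc : ContDiffOn ℝ (⊤ : ℕ∞) c (Icc (0 : ℝ) 1)) :
    ∃ M, 0 ≤ M ∧ ∀ x ∈ Icc (0 : ℝ) 1, |c x| ≤ M := by
  obtain ⟨M, hM⟩ := isCompact_Icc.exists_bound_of_continuousOn hc.continuousOn
  exact ⟨M, (norm_nonneg _).trans (hM 0 (by simp)), hM⟩

lemma _root_.ContDiffOn.iteratedDeriv_Ioo {u : ℝ → ℝ}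
    (hu : ContDiffOn ℝ (⊤ : ℕ∞) u (Icc (0 : ℝ) 1)) (k : ℕ) :
    ContDiffOn ℝ (⊤ : ℕ∞) (iteratedDeriv k u) (Ioo (0 : ℝ) 1) := by
  induction k with
  | zero => simpa using hu.mono Ioo_subset_Icc_self
  | succ k ih =>
    rw [iteratedDeriv_succ]
    exact ih.deriv_of_isOpen isOpen_Ioo (by simp)

lemma _root_.ContDiffOn.hasDerivAt_iteratedDeriv {u : ℝ → ℝ}
    (hu : ContDiffOn ℝ (⊤ : ℕ∞) u (Icc (0 : ℝ) 1)) (k : ℕ) {x : ℝ} (hx : x ∈ Ioo (0 : ℝ) 1) :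
    HasDerivAt (iteratedDeriv k u) (iteratedDeriv (k + 1) u x) x := by
  rw [iteratedDeriv_succ]
  exact (((hu.iteratedDeriv_Ioo k).differentiableOn (by simp) x hx).differentiableAt
    (isOpen_Ioo.mem_nhds hx)).hasDerivAt

/-- The equation satisfied by the derivatives of a solution. -/
lemma exists_differentiated_equation {p b f : ℝ → ℝ}
    (hp : ContDiffOn ℝ (⊤ : ℕ∞) p (Icc (0 : ℝ) 1))
    (hb : ContDiffOn ℝ (⊤ : ℕ∞) b (Icc (0 : ℝ) 1))
    (hf : ContDiffOn ℝ (⊤ : ℕ∞) f (Icc (0 : ℝ) 1)) (k : ℕ) :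
    ∃ (c : ℕ → ℝ → ℝ) (F : ℝ → ℝ),
      (∀ j, ContDiffOn ℝ (⊤ : ℕ∞) (c j) (Icc (0 : ℝ) 1)) ∧
      ContDiffOn ℝ (⊤ : ℕ∞) F (Icc (0 : ℝ) 1) ∧
      ∀ ε u, IsSol p b f ε u → ∀ x ∈ Ioo (0 : ℝ) 1,
        ε * iteratedDeriv (k + 2) u x = p x * iteratedDeriv (k + 1) u x +
          (∑ j ∈ Finset.range (k + 1), c j x * iteratedDeriv j u x + F x) := by
  induction k with
  | zero =>
    refine ⟨fun _ => b, fun x => -f x, fun _ => hb, hf.neg, fun ε u hu x hx => ?_⟩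
    have := hu.2 x hx
    simp only [iteratedDeriv_succ, iteratedDeriv_zero, zero_add, Finset.sum_range_one]
    linarith
  | succ k ih =>
    obtain ⟨c, F, hc, hF, h⟩ := ih
    let D : (ℝ → ℝ) → ℝ → ℝ := fun c => derivWithin c (Icc 0 1)
    let c' : ℕ → ℝ → ℝ := fun j => Nat.casesOn j (D (c 0))
      (fun j x => if j = k then D p x + c k x else D (c (j + 1)) x + c j x)
    refine ⟨c', D F, fun j => ?_, hF.derivWithin_Icc, fun ε u hu x hx => ?_⟩
    · rcases j with _ | j
      · exact (hc 0).derivWithin_Icc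
      · by_cases hj : j = k
        · simpa [c', hj] using hp.derivWithin_Icc.add (hc k)
        · simpa [c', hj] using (hc (j + 1)).derivWithin_Icc.add (hc j)
    · have hU := fun j => hu.1.hasDerivAt_iteratedDeriv j hx
      have hL : HasDerivAt (fun t => ε * iteratedDeriv (k + 2) u t)
          (ε * iteratedDeriv (k + 3) u x) x := (hU (k + 2)).const_mul ε
      have hR := ((hp.hasDerivAt_derivWithin hx).mul (hU (k + 1))).add
        ((HasDerivAt.fun_sum (u := Finset.range (k + 1)) (fun j _ =>
          ((hc j).hasDerivAt_derivWithin hx).mul (hU j))).add (hF.hasDerivAt_derivWithin hx))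
      have heq := hL.unique (hR.congr_of_eventuallyEq
        (Filter.eventuallyEq_of_mem (isOpen_Ioo.mem_nhds hx) (fun t ht => h ε u hu t ht)))
      have hsum : ∑ j ∈ Finset.range (k + 2), c' j x * iteratedDeriv j u x =
          D p x * iteratedDeriv (k + 1) u x +
          ∑ j ∈ Finset.range (k + 1),
            (D (c j) x * iteratedDeriv j u x + c j x * iteratedDeriv (j + 1) u x) := by
        have hmid : ∑ j ∈ Finset.range k, c' (j + 1) x * iteratedDeriv (j + 1) u x =
            ∑ j ∈ Finset.range k, D (c (j + 1)) x * iteratedDeriv (j + 1) u x +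
            ∑ j ∈ Finset.range k, c j x * iteratedDeriv (j + 1) u x := by
          rw [← Finset.sum_add_distrib]
          refine Finset.sum_congr rfl fun j hj => ?_
          simp only [c', if_neg (Finset.mem_range.1 hj).ne]
          ring
        rw [Finset.sum_add_distrib, Finset.sum_range_succ', Finset.sum_range_succ, hmid,
          Finset.sum_range_succ' (fun j => D (c j) x * iteratedDeriv j u x),
          Finset.sum_range_succ (fun j => c j x * iteratedDeriv (j + 1) u x)]
        have hzero : c' 0 x = D (c 0) x := rfl
        have htop : c' (k + 1) x = D p x + c k x := if_pos rfl
        rw [hzero, htop]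
        ring
      rw [show k + 1 + 1 = k + 2 from rfl, hsum]
      linarith

/-- One-sided maximum principle. -/
lemma le_of_isSol {p b f : ℝ → ℝ} {b₀ ε F M : ℝ} {u : ℝ → ℝ} (hε : 0 < ε) (hb₀ : 0 < b₀)
    (hblb : ∀ x ∈ Icc (0 : ℝ) 1, b₀ ≤ b x) (hfF : ∀ x ∈ Icc (0 : ℝ) 1, |f x| ≤ F)
    (hu : IsSol p b f ε u) (h0 : u 0 ≤ M) (h1 : u 1 ≤ M) (hM : F / b₀ ≤ M) :
    ∀ x ∈ Icc (0 : ℝ) 1, u x ≤ M := by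
  obtain ⟨z, hz, hmax⟩ := isCompact_Icc.exists_isMaxOn (nonempty_Icc.2 zero_le_one)
    hu.1.continuousOn
  suffices u z ≤ M from fun x hx => (hmax hx : u x ≤ u z).trans this
  rcases eq_or_lt_of_le hz.1 with rfl | hz0
  · exact h0
  rcases eq_or_lt_of_le hz.2 with rfl | hz1
  · exact h1
  have hloc : IsLocalMax u z := hmax.isLocalMax (Icc_mem_nhds hz0 hz1)
  have hd1 := hloc.deriv_eq_zero
  have hd2 : deriv (deriv u) z ≤ 0 := by
    by_contra! hpos
    have hmin := isLocalMin_of_deriv_deriv_pos hpos hd1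
      (hu.1.continuousOn.continuousAt (Icc_mem_nhds hz0 hz1))
    have hconst : u =ᶠ[𝓝 z] fun _ => u z := by
      filter_upwards [hloc, hmin] with t h1 h2 using le_antisymm h1 h2
    have := hconst.deriv.deriv_eq
    simp at this
    linarith
  have heq := hu.2 z ⟨hz0, hz1⟩
  rw [hd1] at heq
  have hbu : b z * u z ≤ F := by
    nlinarith [le_abs_self (f z), hfF z hz, mul_nonneg hε.le (neg_nonneg.2 hd2)]
  have hF0 : 0 ≤ F := (abs_nonneg _).trans (hfF z hz)
  refine le_trans ?_ hM
  by_contra! h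
  rw [div_lt_iff₀ hb₀] at h
  have hupos : 0 < u z := by
    by_contra! hn
    nlinarith
  nlinarith [hblb z hz]

/-- Solutions are bounded uniformly in `ε`. -/
lemma exists_abs_le_of_isSol {p b f : ℝ → ℝ} {b₀ : ℝ} (hb₀ : 0 < b₀)
    (hf : ContDiffOn ℝ (⊤ : ℕ∞) f (Icc (0 : ℝ) 1))
    (hblb : ∀ x ∈ Icc (0 : ℝ) 1, b₀ ≤ b x) (uL uR : ℝ) :
    ∃ M, 0 ≤ M ∧ ∀ ε u, 0 < ε → IsSol p b f ε u → u 0 = uL → u 1 = uR →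
      ∀ x ∈ Icc (0 : ℝ) 1, |u x| ≤ M := by
  obtain ⟨F, hF0, hF⟩ := hf.exists_abs_le
  have hq : 0 ≤ F / b₀ := by positivity
  have hL := abs_nonneg uL
  have hR := abs_nonneg uR
  refine ⟨|uL| + |uR| + F / b₀, by positivity, fun ε u hε hu h0 h1 x hx => ?_⟩
  have hneg : IsSol p b (fun x => -f x) ε (fun x => -u x) := by
    refine ⟨hu.1.neg, fun x hx => ?_⟩
    have := hu.2 x hx
    simp only [deriv.fun_neg']
    linarith
  rw [abs_le']
  constructor
  · exact le_of_isSol hε hb₀ hblb hF hu (by rw [h0]; linarith [le_abs_self uL])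
      (by rw [h1]; linarith [le_abs_self uR]) (by linarith) x hx
  · exact le_of_isSol hε hb₀ hblb (by simpa using hF) hneg
      (by rw [h0]; linarith [neg_abs_le uL])
      (by rw [h1]; linarith [neg_abs_le uR]) (by linarith) x hx

/-- The convection coefficient grows at least linearly away from the turning point. -/
lemma mul_le_of_deriv_bound {p : ℝ → ℝ} (hp0 : p 0 = 0) (hp'0 : 0 < deriv p 0)
    (hp'lb : ∀ x ∈ Icc (0 : ℝ) 1, deriv p 0 / 2 ≤ |deriv p x|) :
    ∀ x ∈ Ioo (0 : ℝ) 1, deriv p 0 / 2 * x ≤ p x := by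
  have hne : ∀ x ∈ Icc (0 : ℝ) 1, deriv p x ≠ 0 := fun x hx h => by
    have := hp'lb x hx
    rw [h, abs_zero] at this
    linarith
  have hdiff : ∀ x ∈ Icc (0 : ℝ) 1, DifferentiableAt ℝ p x := fun x hx =>
    differentiableAt_of_deriv_ne_zero (hne x hx)
  have h0mem : (0 : ℝ) ∈ Icc (0 : ℝ) 1 := by simp
  have hpos : ∀ x ∈ Icc (0 : ℝ) 1, 0 < deriv p x := by
    rcases hasDerivWithinAt_forall_lt_or_forall_gt_of_forall_ne (convex_Icc 0 1)
      (fun x hx => (hdiff x hx).hasDerivAt.hasDerivWithinAt) hne with h | h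
    · exact absurd (h 0 h0mem) hp'0.not_gt
    · exact h
  intro x hx
  have := (convex_Icc (0 : ℝ) 1).mul_sub_le_image_sub_of_le_deriv
    (fun x hx => (hdiff x hx).continuousAt.continuousWithinAt)
    (fun x hx => (hdiff x (interior_subset hx)).differentiableWithinAt)
    (C := deriv p 0 / 2)
    (fun x hx => by
      have hx' := interior_subset hx
      simpa [abs_of_pos (hpos x hx')] using hp'lb x hx')
    0 h0mem x (Ioo_subset_Icc_self hx) hx.1.le
  simpa [hp0] using this

lemma exists_abs_iteratedDeriv_le {p b f : ℝ → ℝ} {b₀ : ℝ} (hb₀ : 0 < b₀)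
    (hp : ContDiffOn ℝ (⊤ : ℕ∞) p (Icc (0 : ℝ) 1))
    (hb : ContDiffOn ℝ (⊤ : ℕ∞) b (Icc (0 : ℝ) 1))
    (hf : ContDiffOn ℝ (⊤ : ℕ∞) f (Icc (0 : ℝ) 1))
    (hp0 : p 0 = 0) (hp'0 : 0 < deriv p 0)
    (hp'lb : ∀ x ∈ Icc (0 : ℝ) 1, deriv p 0 / 2 ≤ |deriv p x|)
    (hblb : ∀ x ∈ Icc (0 : ℝ) 1, b₀ ≤ b x) (uL uR : ℝ) (k : ℕ) :
    ∃ C, 0 ≤ C ∧ ∀ ε u, 0 < ε → IsSol p b f ε u → u 0 = uL → u 1 = uR →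
      ∀ x ∈ Ioo (0 : ℝ) 1, |iteratedDeriv k u x| ≤ C / scale ε x ^ k := by
  induction k using Nat.strong_induction_on with
  | _ k ih =>
  rcases k with _ | k
  · obtain ⟨M, hM0, hM⟩ := exists_abs_le_of_isSol (p := p) hb₀ hf hblb uL uR
    exact ⟨M, hM0, fun ε u hε hu h0 h1 x hx => by
      simpa using hM ε u hε hu h0 h1 x (Ioo_subset_Icc_self hx)⟩
  · choose! C hC0 hC using ih
    obtain ⟨c, F, hc, hF, heq⟩ := exists_differentiated_equation hp hb hf k
    choose M hM0 hM using fun j => (hc j).exists_abs_le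
    obtain ⟨N, hN0, hN⟩ := hF.exists_abs_le
    have hCr : ∀ j ∈ Finset.range (k + 1), 0 ≤ C j := fun j hj => hC0 j (Finset.mem_range.1 hj)
    have hB : 0 ≤ ∑ j ∈ Finset.range (k + 1), M j * C j + N :=
      add_nonneg (Finset.sum_nonneg fun j hj => mul_nonneg (hM0 j) (hCr j hj)) hN0
    have hα : 0 < deriv p 0 / 2 := by linarith
    have hCk := hC0 k (Nat.lt_succ_self k)
    refine ⟨_, ?_, fun ε u hε hu h0 h1 => abs_deriv_le k hε hα hCk hB
      (mul_le_of_deriv_bound hp0 hp'0 hp'lb) (fun x hx => hu.1.hasDerivAt_iteratedDeriv k hx)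
      (fun x hx => hu.1.hasDerivAt_iteratedDeriv (k + 1) hx) (heq ε u hu)
      (hC k (Nat.lt_succ_self k) ε u hε hu h0 h1) (fun x hx => ?_)⟩
    · positivity
    · have hd := scale_pos (ε := ε) hx
      have hd1 := scale_le_one (ε := ε) hx
      have hx' := Ioo_subset_Icc_self hx
      rw [add_div, Finset.sum_div]
      refine (abs_add_le _ _).trans (add_le_add ((Finset.abs_sum_le_sum_abs _ _).trans
        (Finset.sum_le_sum fun j hj => ?_)) ?_)
      · have hjk : j ≤ k := Nat.lt_succ_iff.1 (Finset.mem_range.1 hj)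
        have hCj := hCr j hj
        rw [abs_mul]
        calc |c j x| * |iteratedDeriv j u x| ≤ M j * (C j / scale ε x ^ j) :=
              mul_le_mul (hM j x hx') (hC j (Finset.mem_range.1 hj) ε u hε hu h0 h1 x hx)
                (abs_nonneg _) (hM0 j)
          _ ≤ M j * (C j / scale ε x ^ k) := by
              have hMj := hM0 j
              have := pow_le_pow_of_le_one hd.le hd1 hjk
              gcongr
          _ = M j * C j / scale ε x ^ k := by ring
      · exact (hN x hx').trans (le_div_self hN0 (by positivity) (pow_le_one₀ hd.le hd1))

end TurningPoint

/-- Remark 2.1: for the single boundary turning point problem with `p'(0) > 0`,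
the `k`-th derivative of the solution satisfies
`|u^{(k)}(x)| ≤ C (1 + max{x, √ε}^{-k} + (1-x)^{-k})` on `(0,1)`,
uniformly in `ε ∈ (0,1]`. -/
theorem stmt4 (p b f : ℝ → ℝ) (b₀ : ℝ) (hb₀ : 0 < b₀)
    (hp : ContDiffOn ℝ (⊤ : ℕ∞) p (Icc (0 : ℝ) 1))
    (hb : ContDiffOn ℝ (⊤ : ℕ∞) b (Icc (0 : ℝ) 1))
    (hf : ContDiffOn ℝ (⊤ : ℕ∞) f (Icc (0 : ℝ) 1))
    (hp0 : p 0 = 0) (hp'0 : 0 < deriv p 0)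
    (hp'lb : ∀ x ∈ Icc (0 : ℝ) 1, deriv p 0 / 2 ≤ |deriv p x|)
    (hblb : ∀ x ∈ Icc (0 : ℝ) 1, b₀ ≤ b x)
    (uL uR : ℝ) (k : ℕ) (hk : 1 ≤ k) :
    ∃ C > 0, ∀ ε ∈ Ioc (0 : ℝ) 1, ∀ u : ℝ → ℝ,
      ContDiffOn ℝ (⊤ : ℕ∞) u (Icc (0 : ℝ) 1) →
      (∀ x ∈ Ioo (0 : ℝ) 1,
        -ε * deriv (deriv u) x + p x * deriv u x + b x * u x = f x) →
      u 0 = uL → u 1 = uR →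
      ∀ x ∈ Ioo (0 : ℝ) 1,
        |iteratedDeriv k u x| ≤
          C * (1 + (max x (Real.sqrt ε)) ^ (-(k : ℤ)) + (1 - x) ^ (-(k : ℤ))) := by
  obtain ⟨C, hC0, hC⟩ := TurningPoint.exists_abs_iteratedDeriv_le hb₀ hp hb hf hp0 hp'0 hp'lb
    hblb uL uR k
  refine ⟨C + 1, by positivity, fun ε hε u hu heq h0 h1 x hx => ?_⟩
  have hm : 0 < max x (Real.sqrt ε) := lt_max_of_lt_left hx.1
  have h1x : 0 < 1 - x := by linarith [hx.2]
  have hle : (TurningPoint.scale ε x ^ k)⁻¹ ≤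
      1 + (max x (Real.sqrt ε)) ^ (-(k : ℤ)) + (1 - x) ^ (-(k : ℤ)) := by
    rw [zpow_neg, zpow_neg, zpow_natCast, zpow_natCast]
    have i1 : 0 < (max x (Real.sqrt ε) ^ k)⁻¹ := by positivity
    have i2 : 0 < ((1 - x) ^ k)⁻¹ := by positivity
    rcases min_choice (max x (Real.sqrt ε)) (1 - x) with h | h <;>
      rw [TurningPoint.scale, h] <;> linarith
  have hs : 0 < (TurningPoint.scale ε x ^ k)⁻¹ :=
    inv_pos.2 (pow_pos (TurningPoint.scale_pos hx) k)
  calc |iteratedDeriv k u x| ≤ C * (TurningPoint.scale ε x ^ k)⁻¹ := by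
        rw [← div_eq_mul_inv]
        exact hC ε u hε.1 ⟨hu, heq⟩ h0 h1 x hx
    _ ≤ (C + 1) * (TurningPoint.scale ε x ^ k)⁻¹ := by gcongr; linarith
    _ ≤ _ := by gcongr
end

section
/- Let p, b, f : [0,1] → ℝ be infinitely differentiable with p(0) = 0, p'(0) > 0, |p'(x)| ≥ p'(0)/2 for all x ∈ [0,1], and b(x) ≥ b₀ > 0, and fix boundary values u_L, u_R ∈ ℝ. Then there exists a constant C > 0, independent of ε, such that for every ε ∈ (0,1] the solution u of -ε u'' + p u' + b u = f on (0,1) with u(0) = u_L, u(1) = u_R satisfies |x u'(x)| ≤ C for all x ∈ [0, 1/2] and |(1-x) u'(x)| ≤ C for all x ∈ [1/2, 1]. -/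
open Set

/-- The second-order necessary condition at an interior local maximum. -/
lemma IsLocalMax.deriv_deriv_nonpos {u : ℝ → ℝ} {t : ℝ} (h : IsLocalMax u t)
    (hc : ContinuousAt u t) : deriv (deriv u) t ≤ 0 := by
  by_contra! hpos
  have hmin := isLocalMin_of_deriv_deriv_pos hpos h.deriv_eq_zero hc
  have hconst : u =ᶠ[nhds t] fun _ => u t := by
    filter_upwards [h, hmin] with y hy hy' using le_antisymm hy hy'
  have hzero : deriv (deriv u) t = 0 := by
    rw [hconst.deriv.deriv_eq]
    simp
  exact hpos.ne' hzero

/-- The derivative is nonpositive at the left endpoint of an interval if the maximum over the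
interval is attained there. -/
lemma deriv_nonpos_of_isMaxOn_Icc {w : ℝ → ℝ} {t c : ℝ} (htc : t < c)
    (hmax : IsMaxOn w (Icc t c) t) (hd : DifferentiableAt ℝ w t) : deriv w t ≤ 0 := by
  have hcone : c - t ∈ posTangentConeAt (Icc t c) t := by
    apply sub_mem_posTangentConeAt_of_segment_subset
    rw [segment_eq_Icc htc.le]
  have h := hmax.localize.hasFDerivWithinAt_nonpos
    hd.hasDerivAt.hasFDerivAt.hasFDerivWithinAt hcone
  simp only [ContinuousLinearMap.toSpanSingleton_apply, smul_eq_mul] at h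
  nlinarith

/-- The maximum principle for `-ε u'' + p u' + b u` with `b` bounded below by `b₀ > 0`. -/
lemma le_of_convection_diffusion_le_s5 {p b u : ℝ → ℝ} {ε b₀ M : ℝ} (hε : 0 < ε) (hb₀ : 0 < b₀)
    (hM : 0 ≤ M) (hb : ∀ x ∈ Icc (0 : ℝ) 1, b₀ ≤ b x) (hu : ContinuousOn u (Icc 0 1))
    (hle : ∀ x ∈ Ioo (0 : ℝ) 1,
      -ε * deriv (deriv u) x + p x * deriv u x + b x * u x ≤ b₀ * M)
    (h0 : u 0 ≤ M) (h1 : u 1 ≤ M) : ∀ x ∈ Icc (0 : ℝ) 1, u x ≤ M := by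
  obtain ⟨t, ht, hmax⟩ := isCompact_Icc.exists_isMaxOn (nonempty_Icc.2 zero_le_one) hu
  suffices u t ≤ M from fun x hx => (hmax hx).trans this
  rcases eq_or_lt_of_le ht.1 with rfl | ht0
  · exact h0
  rcases eq_or_lt_of_le ht.2 with rfl | ht1
  · exact h1
  have hnhds : Icc (0 : ℝ) 1 ∈ nhds t := Icc_mem_nhds ht0 ht1
  have hloc : IsLocalMax u t := hmax.isLocalMax hnhds
  have hdd := hloc.deriv_deriv_nonpos (hu.continuousAt hnhds)
  have h := hle t ⟨ht0, ht1⟩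
  rw [hloc.deriv_eq_zero] at h
  have hbu : b t * u t ≤ b₀ * M := by nlinarith
  by_contra! hlt
  nlinarith [hb t ht]

/-- If `q w - G ≤ ε w'` on `[x, c]` with `q ≥ κ > 0`, then `w` is controlled backwards from `c`. -/
lemma le_add_of_mul_sub_le_deriv {q w : ℝ → ℝ} {ε κ G x c : ℝ} (hε : 0 < ε) (hκ : 0 < κ)
    (hG : 0 ≤ G) (hxc : x ≤ c) (hw : ∀ t ∈ Icc x c, DifferentiableAt ℝ w t)
    (hq : ∀ t ∈ Icc x c, κ ≤ q t) (hle : ∀ t ∈ Icc x c, q t * w t - G ≤ ε * deriv w t) :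
    w x ≤ |w c| + G / κ := by
  obtain ⟨t, ht, hmax⟩ := isCompact_Icc.exists_isMaxOn (nonempty_Icc.2 hxc)
    (fun t ht => (hw t ht).continuousAt.continuousWithinAt)
  refine (hmax (left_mem_Icc.2 hxc)).trans ?_
  have hGκ : 0 ≤ G / κ := by positivity
  rcases eq_or_lt_of_le ht.2 with rfl | htc
  · linarith [le_abs_self (w t)]
  have hd := deriv_nonpos_of_isMaxOn_Icc htc (hmax.on_subset (Icc_subset_Icc_left ht.1)) (hw t ht)
  suffices w t ≤ G / κ by linarith [abs_nonneg (w c)]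
  rw [le_div_iff₀ hκ]
  by_contra! hlt
  have hwt : 0 < w t := pos_of_mul_pos_left (hG.trans_lt hlt) hκ.le
  nlinarith [hle t ht, hq t ht]

/-- One-sided derivative bound for bounded solutions of `ε u'' = p u' - g` with `p x ≥ α x`. -/
lemma weighted_deriv_le {p u g : ℝ → ℝ} {ε α M G : ℝ} (hε : 0 < ε) (hα : 0 < α) (hG : 0 ≤ G)
    (hp : ∀ x ∈ Icc (0 : ℝ) 1, α * x ≤ p x) (hu : ContDiffOn ℝ 2 u (Icc (0 : ℝ) 1))
    (hode : ∀ x ∈ Ioo (0 : ℝ) 1, -ε * deriv (deriv u) x + p x * deriv u x = g x)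
    (hg : ∀ x ∈ Ioo (0 : ℝ) 1, g x ≤ G) (hM : ∀ x ∈ Icc (0 : ℝ) 1, |u x| ≤ M)
    {x : ℝ} (hx : x ∈ Ioo (0 : ℝ) 1) :
    x * (1 - x) * deriv u x ≤ 2 * M * x + G / α * (1 - x) := by
  have hx0 := hx.1
  have hx1 := hx.2
  have hu' : ContDiffOn ℝ 2 u (Ioo (0 : ℝ) 1) := hu.mono Ioo_subset_Icc_self
  have hdu : ∀ t ∈ Ioo (0 : ℝ) 1, DifferentiableAt ℝ (deriv u) t := fun t ht =>
    ((hu'.deriv_of_isOpen (m := 1) isOpen_Ioo (by norm_num)).differentiableOn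
      (by norm_num)).differentiableAt (isOpen_Ioo.mem_nhds ht)
  obtain ⟨c, hc, hslope⟩ := exists_deriv_eq_slope u hx1
    (hu.continuousOn.mono (Icc_subset_Icc_left hx0.le))
    ((hu'.differentiableOn (by norm_num)).mono (Ioo_subset_Ioo_left hx0.le))
  have hmem : ∀ t ∈ Icc x c, t ∈ Ioo (0 : ℝ) 1 := fun t ht =>
    ⟨hx0.trans_le ht.1, ht.2.trans_lt hc.2⟩
  have hback : deriv u x ≤ |deriv u c| + G / (α * x) := by
    refine le_add_of_mul_sub_le_deriv (q := p) hε (by positivity) hG hc.1.le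
      (fun t ht => hdu t (hmem t ht)) (fun t ht => ?_) (fun t ht => ?_)
    · have := hp t (Ioo_subset_Icc_self (hmem t ht))
      nlinarith [ht.1]
    · linarith [hode t (hmem t ht), hg t (hmem t ht)]
  have h1x : 0 < 1 - x := by linarith
  have hcbound : |deriv u c| * (1 - x) ≤ 2 * M := by
    rw [hslope, abs_div, abs_of_pos h1x, div_mul_cancel₀ _ h1x.ne']
    linarith [abs_sub (u 1) (u x), hM 1 (by simp), hM x (Ioo_subset_Icc_self hx)]
  calc x * (1 - x) * deriv u x ≤ x * (1 - x) * (|deriv u c| + G / (α * x)) := by gcongr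
    _ = |deriv u c| * (1 - x) * x + G / α * (1 - x) := by field_simp
    _ ≤ 2 * M * x + G / α * (1 - x) := by gcongr

/-- A function vanishing at `0` whose derivative is bounded away from `0` on `[0, 1]` and positive
at `0` grows at least linearly. -/
lemma mul_le_of_le_abs_deriv {p : ℝ → ℝ} {α : ℝ} (hα : 0 < α) (hp0 : p 0 = 0)
    (hp'0 : 0 < deriv p 0) (hp' : ∀ x ∈ Icc (0 : ℝ) 1, α ≤ |deriv p x|) :
    ∀ x ∈ Icc (0 : ℝ) 1, α * x ≤ p x := by
  have hne : ∀ x ∈ Icc (0 : ℝ) 1, deriv p x ≠ 0 := fun x hx => abs_pos.1 (hα.trans_le (hp' x hx))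
  have hd : ∀ x ∈ Icc (0 : ℝ) 1, DifferentiableAt ℝ p x := fun x hx =>
    differentiableAt_of_deriv_ne_zero (hne x hx)
  have hpos : ∀ x ∈ Icc (0 : ℝ) 1, 0 < deriv p x := by
    refine (hasDerivWithinAt_forall_lt_or_forall_gt_of_forall_ne (convex_Icc 0 1)
      (fun x hx => (hd x hx).hasDerivAt.hasDerivWithinAt) hne).resolve_left fun h => ?_
    exact (h 0 (by simp)).not_gt hp'0
  intro x hx
  have h := Convex.mul_sub_le_image_sub_of_le_deriv (convex_Icc (0 : ℝ) 1)
    (fun y hy => (hd y hy).continuousAt.continuousWithinAt)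
    (fun y hy => (hd y (interior_subset hy)).differentiableWithinAt)
    (fun y hy => by
      have hy' := interior_subset hy
      simpa [abs_of_pos (hpos y hy')] using hp' y hy') 0 (by simp) x hx hx.1
  simpa [hp0] using h

/-- Proposition 2.3: for the single boundary turning point problem with
`p'(0) > 0`, `|x u'(x)| ≤ C` on `[0,1/2]` and `|(1-x) u'(x)| ≤ C` on `[1/2,1]`,
uniformly in `ε ∈ (0,1]`. -/
theorem stmt5 (p b f : ℝ → ℝ) (b₀ : ℝ) (hb₀ : 0 < b₀)
    (hp : ContDiffOn ℝ (⊤ : ℕ∞) p (Icc (0 : ℝ) 1))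
    (hb : ContDiffOn ℝ (⊤ : ℕ∞) b (Icc (0 : ℝ) 1))
    (hf : ContDiffOn ℝ (⊤ : ℕ∞) f (Icc (0 : ℝ) 1))
    (hp0 : p 0 = 0) (hp'0 : 0 < deriv p 0)
    (hp'lb : ∀ x ∈ Icc (0 : ℝ) 1, deriv p 0 / 2 ≤ |deriv p x|)
    (hblb : ∀ x ∈ Icc (0 : ℝ) 1, b₀ ≤ b x)
    (uL uR : ℝ) :
    ∃ C > 0, ∀ ε ∈ Ioc (0 : ℝ) 1, ∀ u : ℝ → ℝ,
      ContDiffOn ℝ 2 u (Icc (0 : ℝ) 1) →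
      (∀ x ∈ Ioo (0 : ℝ) 1,
        -ε * deriv (deriv u) x + p x * deriv u x + b x * u x = f x) →
      u 0 = uL → u 1 = uR →
      (∀ x ∈ Icc (0 : ℝ) (1 / 2), |x * deriv u x| ≤ C) ∧
      (∀ x ∈ Icc (1 / 2 : ℝ) 1, |(1 - x) * deriv u x| ≤ C) := by
  set α := deriv p 0 / 2 with hα_def
  have hα : 0 < α := by positivity
  have hpα := mul_le_of_le_abs_deriv hα hp0 hp'0 hp'lb
  obtain ⟨F, hF⟩ := isCompact_Icc.exists_bound_of_continuousOn hf.continuousOn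
  obtain ⟨B, hB⟩ := isCompact_Icc.exists_bound_of_continuousOn hb.continuousOn
  simp only [Real.norm_eq_abs] at hF hB
  have hF0 : 0 ≤ F := (abs_nonneg _).trans (hF 0 (by simp))
  have hB0 : 0 ≤ B := (abs_nonneg _).trans (hB 0 (by simp))
  set M := |uL| + |uR| + F / b₀ with hM_def
  have hM0 : 0 ≤ M := by positivity
  have hFb : 0 ≤ F / b₀ := by positivity
  have hLM : |uL| ≤ M := by linarith [abs_nonneg uR]
  have hRM : |uR| ≤ M := by linarith [abs_nonneg uL]
  have hFM : F ≤ b₀ * M := by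
    rw [← div_le_iff₀' hb₀]
    linarith [abs_nonneg uL, abs_nonneg uR]
  set G := F + B * M with hG_def
  have hG0 : 0 ≤ G := by positivity
  have hGα : 0 ≤ G / α := by positivity
  refine ⟨2 * (2 * M + G / α) + 1, by positivity, fun ε hε u hu hode h0 h1 => ?_⟩
  have hε0 := hε.1
  have hupper : ∀ x ∈ Icc (0 : ℝ) 1, u x ≤ M := by
    refine le_of_convection_diffusion_le_s5 (p := p) hε0 hb₀ hM0 hblb hu.continuousOn
      (fun x hx => ?_) (h0 ▸ (le_abs_self _).trans hLM) (h1 ▸ (le_abs_self _).trans hRM)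
    rw [hode x hx]
    exact (le_abs_self _).trans ((hF x (Ioo_subset_Icc_self hx)).trans hFM)
  have hlower : ∀ x ∈ Icc (0 : ℝ) 1, -u x ≤ M := by
    refine le_of_convection_diffusion_le_s5 (p := p) (u := fun x => -u x) hε0 hb₀ hM0 hblb
      hu.continuousOn.neg (fun x hx => ?_) (h0 ▸ (neg_le_abs _).trans hLM)
      (h1 ▸ (neg_le_abs _).trans hRM)
    simp only [deriv.fun_neg']
    linarith [hode x hx, neg_le_abs (f x), hF x (Ioo_subset_Icc_self hx)]
  have huM : ∀ x ∈ Icc (0 : ℝ) 1, |u x| ≤ M := fun x hx =>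
    abs_le.2 ⟨by linarith [hlower x hx], hupper x hx⟩
  have hg : ∀ x ∈ Ioo (0 : ℝ) 1, |f x - b x * u x| ≤ G := fun x hx => by
    have hx' := Ioo_subset_Icc_self hx
    calc |f x - b x * u x| ≤ |f x| + |b x| * |u x| := by
          rw [← abs_mul]
          exact abs_sub _ _
      _ ≤ F + B * M := by
          gcongr
          exacts [hF x hx', hB x hx', huM x hx']
  have hbound : ∀ x ∈ Ioo (0 : ℝ) 1, x * (1 - x) * |deriv u x| ≤ 2 * M + G / α := by
    intro x hx
    have hpos := weighted_deriv_le (g := fun x => f x - b x * u x) hε0 hα hG0 hpα hu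
      (fun y hy => by linarith [hode y hy]) (fun y hy => (le_abs_self _).trans (hg y hy)) huM hx
    have hneg := weighted_deriv_le (u := fun x => -u x) (g := fun x => -(f x - b x * u x))
      hε0 hα hG0 hpα hu.neg
      (fun y hy => by
        simp only [deriv.fun_neg']
        linarith [hode y hy])
      (fun y hy => (neg_le_abs _).trans (hg y hy)) (by simpa using huM) hx
    simp only [deriv.fun_neg'] at hneg
    have hsum : 2 * M * x + G / α * (1 - x) ≤ 2 * M + G / α := by nlinarith [hx.1, hx.2]
    rcases abs_cases (deriv u x) with h | h <;> rw [h.1] <;> linarith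
  constructor
  · intro x hx
    rcases eq_or_lt_of_le hx.1 with rfl | hx0
    · rw [zero_mul, abs_zero]
      positivity
    · rw [abs_mul, abs_of_pos hx0]
      have h := hbound x ⟨hx0, by linarith [hx.2]⟩
      have h' : 0 ≤ x * |deriv u x| := by positivity
      nlinarith [hx.2]
  · intro x hx
    rcases eq_or_lt_of_le hx.2 with rfl | hx1
    · rw [sub_self, zero_mul, abs_zero]
      positivity
    · have h1x : 0 < 1 - x := by linarith
      rw [abs_mul, abs_of_pos h1x]
      have h := hbound x ⟨by linarith [hx.1], hx1⟩
      have h' : 0 ≤ (1 - x) * |deriv u x| := by positivity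
      nlinarith [hx.1]
end

section
/- Let p, b, f : [0,1] → ℝ be infinitely differentiable with p(0) = 0, p'(0) < 0, |p'(x)| ≥ |p'(0)|/2 for all x ∈ [0,1], and b(x) ≥ b₀ > 0, and fix boundary values u_L, u_R ∈ ℝ. Then there exists a constant C > 0, independent of ε, such that for every ε ∈ (0,1] the solution u of -ε u'' + p u' + b u = f on (0,1) with u(0) = u_L, u(1) = u_R satisfies |x u'(x)| ≤ C for all x ∈ [0,1]. -/
open Set

/-- The derivative of a function that is `C²` near `x` is differentiable at `x`. -/
lemma differentiableAt_deriv_of_contDiffOn {u : ℝ → ℝ} (hu : ContDiffOn ℝ 2 u (Icc (0 : ℝ) 1))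
    {x : ℝ} (hx : x ∈ Ioo (0 : ℝ) 1) : DifferentiableAt ℝ (deriv u) x := by
  have h1 : ContDiffOn ℝ (1 + 1) u (Ioo (0 : ℝ) 1) := by
    rw [one_add_one_eq_two]
    exact hu.mono Ioo_subset_Icc_self
  have h2 := ((contDiffOn_succ_iff_deriv_of_isOpen isOpen_Ioo).1 h1).2.2
  exact (h2.differentiableOn one_ne_zero).differentiableAt (isOpen_Ioo.mem_nhds hx)

/-- At an interior local maximum the second derivative is not positive. -/
lemma IsLocalMax.not_deriv_deriv_pos {u : ℝ → ℝ} {z : ℝ} (h : IsLocalMax u z)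
    (hc : ContinuousAt u z) : ¬ 0 < deriv (deriv u) z := by
  intro hpos
  have hmin : IsLocalMin u z := isLocalMin_of_deriv_deriv_pos hpos h.deriv_eq_zero hc
  have heq : u =ᶠ[nhds z] fun _ => u z := by
    filter_upwards [h, hmin] with y h1 h2 using le_antisymm h1 h2
  have := heq.deriv.deriv_eq
  simp at this
  linarith

/-- Maximum principle for `-ε u'' + p u' + b u = f`. -/
lemma le_of_turning_point_eq {p b f u : ℝ → ℝ} {b₀ ε M : ℝ} (hb₀ : 0 < b₀) (hε : 0 < ε)
    (hM : 0 ≤ M) (hb : ∀ x ∈ Icc (0 : ℝ) 1, b₀ ≤ b x) (hf : ∀ x ∈ Icc (0 : ℝ) 1, f x ≤ b₀ * M)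
    (hu : ContinuousOn u (Icc (0 : ℝ) 1))
    (heq : ∀ x ∈ Ioo (0 : ℝ) 1,
      -ε * deriv (deriv u) x + p x * deriv u x + b x * u x = f x)
    (h0 : u 0 ≤ M) (h1 : u 1 ≤ M) : ∀ x ∈ Icc (0 : ℝ) 1, u x ≤ M := by
  obtain ⟨z, hz, hmax⟩ := isCompact_Icc.exists_isMaxOn (nonempty_Icc.2 zero_le_one) hu
  intro x hx
  refine (hmax hx).trans ?_
  by_contra! hlt
  have hz0 : z ≠ 0 := by rintro rfl; linarith
  have hz1 : z ≠ 1 := by rintro rfl; linarith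
  have hzI : z ∈ Ioo (0 : ℝ) 1 := ⟨hz.1.lt_of_ne' hz0, hz.2.lt_of_ne hz1⟩
  have hnhds : Icc (0 : ℝ) 1 ∈ nhds z := Icc_mem_nhds hzI.1 hzI.2
  have hloc : IsLocalMax u z := hmax.isLocalMax hnhds
  apply hloc.not_deriv_deriv_pos (hu.continuousAt hnhds)
  have h2 := heq z hzI
  rw [hloc.deriv_eq_zero] at h2
  have h3 := hf z hz
  have h4 : b₀ * M < b z * u z :=
    (mul_lt_mul_of_pos_left hlt hb₀).trans_le
      (mul_le_mul_of_nonneg_right (hb z hz) (hM.trans hlt.le))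
  have h5 : 0 < ε * deriv (deriv u) z := by linarith
  exact pos_of_mul_pos_right h5 hε.le

/-- Solutions of a damped linear equation `ε v' = q v - g` stay below `K`
when `K` exceeds the ratio of the forcing to the damping. -/
lemma le_of_damped_deriv {v q g : ℝ → ℝ} {y x ε k G K : ℝ} (hyx : y ≤ x) (hε : 0 < ε)
    (hK : 0 ≤ K) (hGK : G < k * K) (hd : ∀ t ∈ Icc y x, DifferentiableAt ℝ v t)
    (heq : ∀ t ∈ Icc y x, ε * deriv v t = q t * v t - g t)
    (hq : ∀ t ∈ Icc y x, q t ≤ -k) (hg : ∀ t ∈ Icc y x, -g t ≤ G) (hy : v y ≤ K) :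
    v x ≤ K := by
  refine image_le_of_deriv_right_lt_deriv_boundary (f := v) (f' := deriv v)
    (B := fun _ => K) (B' := fun _ => 0)
    (fun t ht => (hd t ht).continuousAt.continuousWithinAt)
    (fun t ht => (hd t (Ico_subset_Icc_self ht)).hasDerivAt.hasDerivWithinAt) hy
    (fun t => hasDerivAt_const t K) ?_ (right_mem_Icc.2 hyx)
  intro t ht hvt
  have ht' := Ico_subset_Icc_self ht
  have h1 := heq t ht'
  rw [hvt] at h1
  have h2 := mul_le_mul_of_nonneg_right (hq t ht') hK
  have h3 := hg t ht'
  by_contra! h4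
  have := mul_nonneg hε.le h4
  linarith

/-- A function vanishing at `0` whose slope is negative at `0` and stays bounded away from
zero lies below a line of negative slope. -/
lemma le_neg_mul_of_abs_deriv_ge {p : ℝ → ℝ} (hp : ContDiffOn ℝ 1 p (Icc (0 : ℝ) 1))
    (hp0 : p 0 = 0) (hp'0 : deriv p 0 < 0)
    (hp'lb : ∀ x ∈ Icc (0 : ℝ) 1, |deriv p 0| / 2 ≤ |deriv p x|) :
    ∀ x ∈ Icc (0 : ℝ) 1, p x ≤ -(|deriv p 0| / 2) * x := by
  have hα : 0 < |deriv p 0| / 2 := by have := abs_pos.2 hp'0.ne; linarith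
  have hcont : ContinuousOn (deriv p) (Ico 0 1) := by
    refine ((hp.continuousOn_derivWithin (uniqueDiffOn_Icc zero_lt_one) le_rfl).mono
      Ico_subset_Icc_self).congr ?_
    intro x hx
    refine (DifferentiableAt.derivWithin ?_
      (uniqueDiffOn_Icc zero_lt_one x (Ico_subset_Icc_self hx))).symm
    rcases hx.1.eq_or_lt with rfl | h
    · exact differentiableAt_of_deriv_ne_zero hp'0.ne
    · exact (hp.differentiableOn one_ne_zero).differentiableAt (Icc_mem_nhds h hx.2)
  have hneg : ∀ x ∈ Ico (0 : ℝ) 1, deriv p x < 0 := by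
    intro x hx
    by_contra! h
    obtain ⟨c, hc, hc0⟩ := isPreconnected_Ico.intermediate_value
      (left_mem_Ico.2 zero_lt_one) hx hcont ⟨hp'0.le, h⟩
    have := hp'lb c (Ico_subset_Icc_self hc)
    rw [hc0, abs_zero] at this
    linarith
  intro x hx
  have := (convex_Icc (0 : ℝ) 1).image_sub_le_mul_sub_of_deriv_le hp.continuousOn
    ((hp.differentiableOn one_ne_zero).mono interior_subset) (C := -(|deriv p 0| / 2)) (by
      intro t ht
      rw [interior_Icc] at ht
      have h1 := hp'lb t (Ioo_subset_Icc_self ht)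
      rw [abs_of_neg (hneg t (Ioo_subset_Ico_self ht))] at h1
      linarith) 0 (left_mem_Icc.2 zero_le_one) x hx hx.1
  rw [hp0] at this
  linarith

/-- A bound for `x * u' x` in the interior of `[0,1]` extends to the end points. -/
lemma abs_mul_deriv_le_of_Ioo {u : ℝ → ℝ} (hu : ContDiffOn ℝ 1 u (Icc (0 : ℝ) 1)) {C : ℝ}
    (hC : 0 ≤ C) (h : ∀ x ∈ Ioo (0 : ℝ) 1, |x * deriv u x| ≤ C) :
    ∀ x ∈ Icc (0 : ℝ) 1, |x * deriv u x| ≤ C := by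
  have hU := uniqueDiffOn_Icc (zero_lt_one (α := ℝ))
  have hcont : ContinuousOn (fun x => |x * derivWithin u (Icc 0 1) x|) (Icc (0 : ℝ) 1) :=
    (continuousOn_id.mul (hu.continuousOn_derivWithin hU le_rfl)).abs
  intro x hx
  by_cases hd : DifferentiableAt ℝ u x
  · rw [← hd.derivWithin (hU x hx)]
    have hcl : closure (Ioo (0 : ℝ) 1) = Icc 0 1 := closure_Ioo zero_ne_one
    refine le_on_closure (s := Ioo (0 : ℝ) 1)
      (f := fun x => |x * derivWithin u (Icc 0 1) x|) (g := fun _ => C) ?_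
      (by rwa [hcl]) continuousOn_const (by rwa [hcl])
    intro t ht
    simpa only [derivWithin_of_mem_nhds (Icc_mem_nhds ht.1 ht.2)] using h t ht
  · simpa [deriv_zero_of_not_differentiableAt hd] using hC

/-- Proposition 2.4: for the single boundary turning point problem with
`p'(0) < 0`, `|x u'(x)| ≤ C` on `[0,1]`, uniformly in `ε ∈ (0,1]`. -/
theorem stmt7 (p b f : ℝ → ℝ) (b₀ : ℝ) (hb₀ : 0 < b₀)
    (hp : ContDiffOn ℝ (⊤ : ℕ∞) p (Icc (0 : ℝ) 1))
    (hb : ContDiffOn ℝ (⊤ : ℕ∞) b (Icc (0 : ℝ) 1))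
    (hf : ContDiffOn ℝ (⊤ : ℕ∞) f (Icc (0 : ℝ) 1))
    (hp0 : p 0 = 0) (hp'0 : deriv p 0 < 0)
    (hp'lb : ∀ x ∈ Icc (0 : ℝ) 1, |deriv p 0| / 2 ≤ |deriv p x|)
    (hblb : ∀ x ∈ Icc (0 : ℝ) 1, b₀ ≤ b x)
    (uL uR : ℝ) :
    ∃ C > 0, ∀ ε ∈ Ioc (0 : ℝ) 1, ∀ u : ℝ → ℝ,
      ContDiffOn ℝ 2 u (Icc (0 : ℝ) 1) →
      (∀ x ∈ Ioo (0 : ℝ) 1,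
        -ε * deriv (deriv u) x + p x * deriv u x + b x * u x = f x) →
      u 0 = uL → u 1 = uR →
      ∀ x ∈ Icc (0 : ℝ) 1, |x * deriv u x| ≤ C := by
  obtain ⟨F, hF⟩ := isCompact_Icc.exists_bound_of_continuousOn hf.continuousOn
  obtain ⟨B, hB⟩ := isCompact_Icc.exists_bound_of_continuousOn hb.continuousOn
  simp only [Real.norm_eq_abs] at hF hB
  have hpα := le_neg_mul_of_abs_deriv_ge (hp.of_le (by exact_mod_cast le_top)) hp0 hp'0 hp'lb
  have hα : 0 < |deriv p 0| := abs_pos.2 hp'0.ne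
  set α := |deriv p 0|
  have h0mem : (0 : ℝ) ∈ Icc (0 : ℝ) 1 := left_mem_Icc.2 zero_le_one
  have hF0 : 0 ≤ F := (abs_nonneg _).trans (hF 0 h0mem)
  have hB0 : 0 ≤ B := (abs_nonneg _).trans (hB 0 h0mem)
  obtain ⟨M, hMdef⟩ : ∃ M, M = |uL| + |uR| + F / b₀ := ⟨_, rfl⟩
  have hFb : 0 ≤ F / b₀ := by positivity
  have hM0 : 0 ≤ M := by rw [hMdef]; positivity
  have hFM : F ≤ b₀ * M := by
    rw [mul_comm, ← div_le_iff₀ hb₀, hMdef]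
    linarith [abs_nonneg uL, abs_nonneg uR]
  have hLM : |uL| ≤ M := by linarith [abs_nonneg uR]
  have hRM : |uR| ≤ M := by linarith [abs_nonneg uL]
  obtain ⟨G, hGdef⟩ : ∃ G, G = F + B * M := ⟨_, rfl⟩
  have hG0 : 0 ≤ G := by rw [hGdef]; positivity
  obtain ⟨C, hCdef⟩ : ∃ C, C = 4 * M + 4 * (G + 1) / α := ⟨_, rfl⟩
  have hCpos : 0 < C := by rw [hCdef]; positivity
  refine ⟨C, hCpos, ?_⟩
  rintro ε ⟨hε, -⟩ u hu heq h0 h1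
  have huM : ∀ x ∈ Icc (0 : ℝ) 1, |u x| ≤ M := by
    intro x hx
    rw [abs_le']
    constructor
    · exact le_of_turning_point_eq hb₀ hε hM0 hblb
        (fun t ht => ((le_abs_self _).trans (hF t ht)).trans hFM) hu.continuousOn heq
        (h0 ▸ (le_abs_self _).trans hLM) (h1 ▸ (le_abs_self _).trans hRM) x hx
    · refine le_of_turning_point_eq (p := p) (f := fun t => -f t) (u := fun t => -u t)
        hb₀ hε hM0 hblb
        (fun t ht => ((neg_le_abs _).trans (hF t ht)).trans hFM) hu.continuousOn.neg ?_
        (by rw [h0]; exact (neg_le_abs _).trans hLM)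
        (by rw [h1]; exact (neg_le_abs _).trans hRM) x hx
      intro t ht
      simp only [deriv.fun_neg']
      linarith [heq t ht]
  refine abs_mul_deriv_le_of_Ioo (hu.of_le one_le_two) hCpos.le fun x hx => ?_
  have hsub : Icc (x / 2) x ⊆ Ioo (0 : ℝ) 1 := fun t ht =>
    ⟨by linarith [ht.1, hx.1], by linarith [ht.2, hx.2]⟩
  have hx2 : x / 2 < x := by linarith [hx.1]
  obtain ⟨y, hy, hyeq⟩ := exists_deriv_eq_slope u hx2
    (hu.continuousOn.mono (hsub.trans Ioo_subset_Icc_self))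
    ((hu.differentiableOn two_ne_zero).mono
      ((Ioo_subset_Icc_self.trans hsub).trans Ioo_subset_Icc_self))
  have hxC : 0 ≤ C / x := div_nonneg hCpos.le hx.1.le
  have hyK : |deriv u y| ≤ C / x := by
    have e : deriv u y = 2 * (u x - u (x / 2)) / x := by
      rw [hyeq]; have := hx.1.ne'; field_simp; ring
    rw [e, abs_div, abs_of_pos hx.1]
    refine div_le_div_of_nonneg_right ?_ hx.1.le
    have a1 := huM x (Ioo_subset_Icc_self hx)
    have a2 := huM (x / 2) (Ioo_subset_Icc_self (hsub (left_mem_Icc.2 hx2.le)))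
    have a3 : 0 ≤ 4 * (G + 1) / α := by positivity
    rw [abs_le] at *
    constructor <;> linarith
  have hGK : G < α * x / 4 * (C / x) := by
    have e : α * x / 4 * (C / x) = α * M + (G + 1) := by
      rw [hCdef]; have := hx.1.ne'; field_simp
    rw [e]
    linarith [mul_nonneg hα.le hM0]
  have hsub' : Icc y x ⊆ Icc (x / 2) x := Icc_subset_Icc_left hy.1.le
  have hq : ∀ t ∈ Icc y x, p t ≤ -(α * x / 4) := fun t ht => by
    have b1 := hpα t (Ioo_subset_Icc_self (hsub (hsub' ht)))
    have b2 := mul_le_mul_of_nonneg_left (hsub' ht).1 hα.le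
    linarith
  have hg : ∀ t ∈ Icc y x, |f t - b t * u t| ≤ G := fun t ht => by
    have ht' := Ioo_subset_Icc_self (hsub (hsub' ht))
    refine (abs_sub _ _).trans ?_
    rw [hGdef, abs_mul]
    exact add_le_add (hF t ht') (mul_le_mul (hB t ht') (huM t ht') (abs_nonneg _) hB0)
  have hd : ∀ t ∈ Icc y x, DifferentiableAt ℝ (deriv u) t := fun t ht =>
    differentiableAt_deriv_of_contDiffOn hu (hsub (hsub' ht))
  have key : |deriv u x| ≤ C / x := by
    rw [abs_le'] at hyK ⊢
    constructor
    · exact le_of_damped_deriv (q := p) (g := fun t => f t - b t * u t) hy.2.le hε hxC hGK hd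
        (fun t ht => by linarith [heq t (hsub (hsub' ht))]) hq
        (fun t ht => (neg_le_abs _).trans (hg t ht)) hyK.1
    · exact le_of_damped_deriv (v := fun t => -deriv u t) (q := p)
        (g := fun t => -(f t - b t * u t)) hy.2.le hε hxC hGK (fun t ht => (hd t ht).neg)
        (fun t ht => by
          simp only [deriv.fun_neg']
          linarith [heq t (hsub (hsub' ht))]) hq
        (fun t ht => by
          rw [neg_neg]
          exact (le_abs_self _).trans (hg t ht)) hyK.2
  rw [abs_mul, abs_of_pos hx.1, mul_comm]
  exact (le_div_iff₀ hx.1).1 key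
end

section
/- Let ε > 0 and let p, b, f : [x_L, x_R] → ℝ be continuous with b(x) ≥ b₀ > 0, and let p̄, b̄, f̄ : [x_L, x_R] → ℝ be bounded functions with b̄(x) ≥ b₀ > 0. Let u ∈ C²([x_L, x_R]) satisfy -ε u'' + p u' + b u = f on (x_L, x_R), and let u_h ∈ C¹([x_L, x_R]) be twice differentiable at all but finitely many points of (x_L, x_R) and satisfy -ε u_h'' + p̄ u_h' + b̄ u_h = f̄ at every such point, with u_h(x_L) = u(x_L) and u_h(x_R) = u(x_R). Then sup |u - u_h| ≤ (1/b₀) · ( sup |(p - p̄) u'| + sup |b - b̄| · sup |u| + sup |f - f̄| ), where all suprema are taken over [x_L, x_R]; in particular the bound is independent of ε. -/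
open Set

open Filter Topology in
/-- One-sided maximum principle for `-ε e'' + p e' + q e ≤ M`, required away from a finite set. -/
theorem le_of_elliptic_inequality_off_finite {ε a c b₀ M K : ℝ} (hε : 0 < ε) (hac : a < c)
    (hb₀ : 0 < b₀) (hM : 0 ≤ M) {p q e e' e'' : ℝ → ℝ}
    (hq : ∀ x ∈ Ioo a c, b₀ ≤ q x) (hp : ∀ x ∈ Ioo a c, |p x| ≤ K)
    (he : ContinuousOn e (Icc a c)) (hd : ∀ x ∈ Ioo a c, HasDerivAt e (e' x) x)
    (hdc : ContinuousOn e' (Ioo a c)) (T : Finset ℝ)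
    (hdd : ∀ x ∈ Ioo a c, x ∉ T →
      HasDerivAt e' (e'' x) x ∧ -ε * e'' x + p x * e' x + q x * e x ≤ M)
    (ha : e a ≤ 0) (hc : e c ≤ 0) : ∀ x ∈ Icc a c, e x ≤ M / b₀ := by
  obtain ⟨x₀, hx₀, hmax⟩ := isCompact_Icc.exists_isMaxOn (nonempty_Icc.2 hac.le) he
  intro x hx
  refine (hmax hx).trans ?_
  by_contra! hlt
  have hm0 : 0 ≤ M / b₀ := by positivity
  have hx₀I : x₀ ∈ Ioo a c := by
    refine ⟨lt_of_le_of_ne hx₀.1 ?_, lt_of_le_of_ne hx₀.2 ?_⟩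
    · rintro rfl; linarith
    · rintro rfl; linarith
  have hnhds : Ioo a c ∈ 𝓝 x₀ := isOpen_Ioo.mem_nhds hx₀I
  have hloc : IsLocalMax e x₀ := by
    filter_upwards [hnhds] with y hy using hmax (Ioo_subset_Icc_self hy)
  have he'0 : e' x₀ = 0 := hloc.hasDerivAt_eq_zero (hd x₀ hx₀I)
  obtain ⟨m, hm1, hm2⟩ := exists_between hlt
  have hev1 : ∀ᶠ y in 𝓝 x₀, m < e y :=
    (hd x₀ hx₀I).continuousAt.eventually (lt_mem_nhds hm2)
  have hev2 : ∀ᶠ y in 𝓝 x₀, K * |e' y| < b₀ * m - M := by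
    have hct : ContinuousAt (fun y => K * |e' y|) x₀ :=
      continuousAt_const.mul (hdc.continuousAt hnhds).abs
    refine hct.eventually (gt_mem_nhds ?_)
    rw [div_lt_iff₀ hb₀] at hm1
    simp only [he'0, abs_zero, mul_zero]
    linarith
  have hev3 : ∀ᶠ y in 𝓝 x₀, y ∉ T.erase x₀ :=
    (T.erase x₀).finite_toSet.isClosed.isOpen_compl.mem_nhds (by simp)
  obtain ⟨r, hr, hball⟩ := Metric.eventually_nhds_iff.1
    ((eventually_mem_set.2 hnhds).and (hev1.and (hev2.and hev3)))
  have hnear : ∀ y ∈ Icc x₀ (x₀ + r / 2), dist y x₀ < r := by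
    intro y hy
    rw [Real.dist_eq, abs_of_nonneg (by linarith [hy.1])]
    linarith [hy.2]
  have hsub : Icc x₀ (x₀ + r / 2) ⊆ Ioo a c := fun y hy => (hball (hnear y hy)).1
  have hmono' : StrictMonoOn e' (Icc x₀ (x₀ + r / 2)) := by
    refine strictMonoOn_of_deriv_pos (convex_Icc _ _) (hdc.mono hsub) ?_
    intro y hy
    rw [interior_Icc] at hy
    obtain ⟨h1, h2, h3, h4⟩ := hball (hnear y (Ioo_subset_Icc_self hy))
    obtain ⟨hD, hI⟩ := hdd y h1 fun hyT => h4 (Finset.mem_erase.2 ⟨hy.1.ne', hyT⟩)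
    rw [hD.deriv]
    have hpe : -(K * |e' y|) ≤ p y * e' y := by
      have h5 := neg_abs_le (p y * e' y)
      rw [abs_mul] at h5
      have h6 := mul_le_mul_of_nonneg_right (hp y h1) (abs_nonneg (e' y))
      linarith
    have hqe : b₀ * m ≤ q y * e y := by
      have hm : 0 ≤ m := hm0.trans hm1.le
      exact mul_le_mul (hq y h1) h2.le hm (hb₀.le.trans (hq y h1))
    have hpos : 0 < ε * e'' y := by linarith
    exact (mul_pos_iff_of_pos_left hε).1 hpos
  have hmono : StrictMonoOn e (Icc x₀ (x₀ + r / 2)) := by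
    refine strictMonoOn_of_deriv_pos (convex_Icc _ _)
      (he.mono (hsub.trans Ioo_subset_Icc_self)) ?_
    intro y hy
    rw [interior_Icc] at hy
    have hyI := Ioo_subset_Icc_self hy
    rw [(hd y (hsub hyI)).deriv, ← he'0]
    exact hmono' (left_mem_Icc.2 (by linarith)) hyI hy.1
  have hright : x₀ + r / 2 ∈ Icc x₀ (x₀ + r / 2) := right_mem_Icc.2 (by linarith)
  have hgt := hmono (left_mem_Icc.2 (by linarith)) hright (by linarith)
  exact absurd (hmax (Ioo_subset_Icc_self (hsub hright))) (not_le.2 hgt)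

/-- Stability of the approximated problem: if `u` solves `-ε u'' + p u' + b u = f`
and `u_h` solves the approximated problem `-ε u_h'' + p̄ u_h' + b̄ u_h = f̄`
(away from finitely many points) with the same boundary data, then
`sup |u - u_h| ≤ (1/b₀)(sup |(p-p̄)u'| + sup|b-b̄| sup|u| + sup|f-f̄|)`,
uniformly in `ε`. -/
theorem stmt9 (ε xL xR b₀ : ℝ) (hε : 0 < ε) (hx : xL < xR) (hb₀ : 0 < b₀)
    (p b f pbar bbar fbar : ℝ → ℝ)
    (hpc : ContinuousOn p (Icc xL xR)) (hbc : ContinuousOn b (Icc xL xR))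
    (hfc : ContinuousOn f (Icc xL xR))
    (hblb : ∀ x ∈ Icc xL xR, b₀ ≤ b x)
    (hbbarlb : ∀ x ∈ Icc xL xR, b₀ ≤ bbar x)
    (hpbarbd : ∃ K, ∀ x ∈ Icc xL xR, |pbar x| ≤ K)
    (hbbarbd : ∃ K, ∀ x ∈ Icc xL xR, |bbar x| ≤ K)
    (hfbarbd : ∃ K, ∀ x ∈ Icc xL xR, |fbar x| ≤ K)
    (u uh : ℝ → ℝ)
    (hu : ContDiffOn ℝ 2 u (Icc xL xR))
    (hueq : ∀ x ∈ Ioo xL xR,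
      -ε * deriv (deriv u) x + p x * deriv u x + b x * u x = f x)
    (huh : ContDiffOn ℝ 1 uh (Icc xL xR))
    (T : Finset ℝ)
    (huheq : ∀ x ∈ Ioo xL xR, x ∉ T →
      DifferentiableAt ℝ (deriv uh) x ∧
      -ε * deriv (deriv uh) x + pbar x * deriv uh x + bbar x * uh x = fbar x)
    (hbL : uh xL = u xL) (hbR : uh xR = u xR)
    (K₁ K₂ K₃ K₄ : ℝ)
    (hK₁ : ∀ x ∈ Icc xL xR, |(p x - pbar x) * deriv u x| ≤ K₁)
    (hK₂ : ∀ x ∈ Icc xL xR, |b x - bbar x| ≤ K₂)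
    (hK₃ : ∀ x ∈ Icc xL xR, |u x| ≤ K₃)
    (hK₄ : ∀ x ∈ Icc xL xR, |f x - fbar x| ≤ K₄) :
    ∀ x ∈ Icc xL xR, |u x - uh x| ≤ (1 / b₀) * (K₁ + K₂ * K₃ + K₄) := by
  obtain ⟨K, hK⟩ := hpbarbd
  have hL : xL ∈ Icc xL xR := left_mem_Icc.2 hx.le
  have hK₁0 : 0 ≤ K₁ := (abs_nonneg _).trans (hK₁ xL hL)
  have hK₂0 : 0 ≤ K₂ := (abs_nonneg _).trans (hK₂ xL hL)
  have hK₃0 : 0 ≤ K₃ := (abs_nonneg _).trans (hK₃ xL hL)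
  have hK₄0 : 0 ≤ K₄ := (abs_nonneg _).trans (hK₄ xL hL)
  have hM : 0 ≤ K₁ + K₂ * K₃ + K₄ := by positivity
  have hsub : Ioo xL xR ⊆ Icc xL xR := Ioo_subset_Icc_self
  have hu' : ContDiffOn ℝ 1 (deriv u) (Ioo xL xR) :=
    (hu.mono hsub).deriv_of_isOpen isOpen_Ioo (by norm_num)
  have huh' : ContinuousOn (deriv uh) (Ioo xL xR) :=
    (huh.mono hsub).continuousOn_deriv_of_isOpen isOpen_Ioo le_rfl
  have hdu : ∀ y ∈ Ioo xL xR, HasDerivAt u (deriv u y) y := fun y hy =>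
    ((hu.differentiableOn (by norm_num)).differentiableAt
      (Icc_mem_nhds hy.1 hy.2)).hasDerivAt
  have hduh : ∀ y ∈ Ioo xL xR, HasDerivAt uh (deriv uh y) y := fun y hy =>
    ((huh.differentiableOn (by norm_num)).differentiableAt
      (Icc_mem_nhds hy.1 hy.2)).hasDerivAt
  have hddu : ∀ y ∈ Ioo xL xR, HasDerivAt (deriv u) (deriv (deriv u) y) y := fun y hy =>
    ((hu'.differentiableOn (by norm_num)).differentiableAt
      (isOpen_Ioo.mem_nhds hy)).hasDerivAt
  have hres : ∀ y ∈ Ioo xL xR, y ∉ T →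
      |-ε * (deriv (deriv u) y - deriv (deriv uh) y) + pbar y * (deriv u y - deriv uh y)
        + bbar y * (u y - uh y)| ≤ K₁ + K₂ * K₃ + K₄ := by
    intro y hy hyT
    have hyI := hsub hy
    have h1 := hueq y hy
    have h2 := (huheq y hy hyT).2
    have hid : -ε * (deriv (deriv u) y - deriv (deriv uh) y) + pbar y * (deriv u y - deriv uh y)
        + bbar y * (u y - uh y)
        = (f y - fbar y) - (p y - pbar y) * deriv u y - (b y - bbar y) * u y := by
      linear_combination h1 - h2
    have h3 : |(b y - bbar y) * u y| ≤ K₂ * K₃ := by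
      rw [abs_mul]
      exact mul_le_mul (hK₂ y hyI) (hK₃ y hyI) (abs_nonneg _) hK₂0
    rw [hid]
    have h4 := abs_sub ((f y - fbar y) - (p y - pbar y) * deriv u y) ((b y - bbar y) * u y)
    have h5 := abs_sub (f y - fbar y) ((p y - pbar y) * deriv u y)
    linarith [hK₁ y hyI, hK₄ y hyI]
  intro x hxI
  rw [one_div, inv_mul_eq_div, abs_le']
  refine ⟨?_, ?_⟩
  · refine le_of_elliptic_inequality_off_finite (e := fun y => u y - uh y)
      (e' := fun y => deriv u y - deriv uh y)
      (e'' := fun y => deriv (deriv u) y - deriv (deriv uh) y) hε hx hb₀ hM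
      (fun y hy => hbbarlb y (hsub hy)) (fun y hy => hK y (hsub hy))
      (hu.continuousOn.sub huh.continuousOn) (fun y hy => (hdu y hy).sub (hduh y hy))
      (hu'.continuousOn.sub huh') T (fun y hy hyT => ⟨?_, ?_⟩)
      (by simp [hbL]) (by simp [hbR]) x hxI
    · exact (hddu y hy).sub (huheq y hy hyT).1.hasDerivAt
    · exact (abs_le.1 (hres y hy hyT)).2
  · rw [neg_sub]
    refine le_of_elliptic_inequality_off_finite (e := fun y => uh y - u y)
      (e' := fun y => deriv uh y - deriv u y)
      (e'' := fun y => deriv (deriv uh) y - deriv (deriv u) y) hε hx hb₀ hM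
      (fun y hy => hbbarlb y (hsub hy)) (fun y hy => hK y (hsub hy))
      (huh.continuousOn.sub hu.continuousOn) (fun y hy => (hduh y hy).sub (hdu y hy))
      (huh'.sub hu'.continuousOn) T (fun y hy hyT => ⟨?_, ?_⟩)
      (by simp [hbL]) (by simp [hbR]) x hxI
    · exact (huheq y hy hyT).1.hasDerivAt.sub (hddu y hy)
    · linarith [(abs_le.1 (hres y hy hyT)).1]
end
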